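/- For every real $\epsilon$ with $0 < \epsilon < 1/2$ there exists a constant $C = C(\epsilon) > 0$ such that for every prime $p$ with $p \equiv 7 \pmod{8}$ one has $Q(p, S_4) - \frac{1}{2}\left\lfloor \frac{p-1}{4} \right\rfloor \ge C\, p^{\frac{1}{2} - \epsilon}$ (as real numbers). -/

import Mathlib

/-- `a` is a quadratic residue modulo `p`: the congruence `x^2 ≡ a (mod p)` has a solution in `ℤ`. -/
def IsQR (p a : ℕ) : Prop := ∃ x : ℤ, x ^ 2 ≡ (a : ℤ) [ZMOD (p : ℤ)]

open Classical in
/-- `Q(p, S_k)`: the number of quadratic residues modulo `p` in `[1, p-1]` that are multiples of `k`. -/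
noncomputable def Qcount (p k : ℕ) : ℕ :=
  ((Finset.Icc 1 (p - 1)).filter fun a => k ∣ a ∧ IsQR p a).card

open Classical in
/-- `N(p, S_k)`: the number of quadratic non-residues modulo `p` in `[1, p-1]` that are multiples of `k`. -/
noncomputable def Ncount (p k : ℕ) : ℕ :=
  ((Finset.Icc 1 (p - 1)).filter fun a => k ∣ a ∧ ¬ IsQR p a).card

open Classical in
/-- `Q(p, 𝒪)`: the number of quadratic residues modulo `p` among the odd integers in `[1, p-1]`. -/
noncomputable def QcountOdd (p : ℕ) : ℕ :=
  ((Finset.Icc 1 (p - 1)).filter fun a => Odd a ∧ IsQR p a).card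

open Classical in
/-- `Q(p, S_2 \ S_4)`: the number of quadratic residues modulo `p` in `[1, p-1]`
divisible by `2` but not by `4`. -/
noncomputable def Qcount2not4 (p : ℕ) : ℕ :=
  ((Finset.Icc 1 (p - 1)).filter fun a => (2 ∣ a ∧ ¬ (4 ∣ a)) ∧ IsQR p a).card

section

open Filter Topology Finset Complex

namespace DirichletCharacter

variable {N : ℕ}

/-- The character sum `χ 1 + ⋯ + χ n`. -/
noncomputable def partialSum (χ : DirichletCharacter ℂ N) (n : ℕ) : ℂ :=
  ∑ k ∈ range n, χ ((k + 1 : ℕ) : ZMod N)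

lemma partialSum_succ (χ : DirichletCharacter ℂ N) (n : ℕ) :
    χ.partialSum (n + 1) = χ.partialSum n + χ ((n + 1 : ℕ) : ZMod N) :=
  sum_range_succ _ _

lemma norm_partialSum_le (χ : DirichletCharacter ℂ N) (n : ℕ) : ‖χ.partialSum n‖ ≤ n := by
  refine (norm_sum_le _ _).trans ((sum_le_card_nsmul _ _ 1 fun i _ ↦ χ.norm_le_one _).trans ?_)
  simp

variable [NeZero N]

lemma sum_range_natCast_zmod {M : Type*} [AddCommMonoid M] (f : ZMod N → M) :
    ∑ k ∈ range N, f (k : ZMod N) = ∑ a, f a := by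
  refine sum_bij' (fun k _ ↦ (k : ZMod N)) (fun a _ ↦ a.val) ?_ ?_ ?_ ?_ ?_
  · simp
  · intro a _
    simpa using ZMod.val_lt a
  · intro k hk
    exact ZMod.val_cast_of_lt (mem_range.mp hk)
  · intro a _
    simp
  · simp

lemma partialSum_add_level {χ : DirichletCharacter ℂ N} (hχ : χ ≠ 1) (n : ℕ) :
    χ.partialSum (n + N) = χ.partialSum n := by
  induction n with
  | zero =>
    have h := sum_range_natCast_zmod (N := N) (fun a ↦ χ (a + 1))
    have h2 : ∑ a, χ (a + 1) = ∑ a, χ a := Equiv.sum_comp (Equiv.addRight (1 : ZMod N)) χ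
    simp only [partialSum, zero_add, range_zero, sum_empty, Nat.cast_add, Nat.cast_one]
    rw [h, h2, χ.sum_eq_zero_of_ne_one hχ]
  | succ n ih =>
    rw [show n + 1 + N = (n + N) + 1 by ring, partialSum_succ, ih, partialSum_succ]
    simp

lemma norm_partialSum_le_level {χ : DirichletCharacter ℂ N} (hχ : χ ≠ 1) (n : ℕ) :
    ‖χ.partialSum n‖ ≤ N := by
  have h : χ.partialSum n = χ.partialSum (n % N) := by
    have : ∀ m k : ℕ, χ.partialSum (m + N * k) = χ.partialSum m := by
      intro m k
      induction k with
      | zero => simp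
      | succ k ih => rw [mul_add, mul_one, ← add_assoc, partialSum_add_level hχ, ih]
    conv_lhs => rw [← Nat.mod_add_div n N]
    exact this _ _
  rw [h]
  refine (norm_partialSum_le _ _).trans ?_
  exact_mod_cast (Nat.mod_lt _ (NeZero.pos N)).le

/-- The terms of the series obtained from `∑ χ n / n ^ s` by summation by parts. -/
noncomputable def abelTerm (χ : DirichletCharacter ℂ N) (n : ℕ) (s : ℂ) : ℂ :=
  χ.partialSum (n + 1) * (((n + 1 : ℕ) : ℂ) ^ (-s) - ((n + 2 : ℕ) : ℂ) ^ (-s))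

omit [NeZero N] in
lemma sum_range_eq_sum_abelTerm (χ : DirichletCharacter ℂ N) (n : ℕ) (s : ℂ) :
    ∑ k ∈ range n, χ ((k + 1 : ℕ) : ZMod N) * ((k + 1 : ℕ) : ℂ) ^ (-s) =
      ∑ k ∈ range n, χ.abelTerm k s + χ.partialSum n * ((n + 1 : ℕ) : ℂ) ^ (-s) := by
  induction n with
  | zero => simp [partialSum]
  | succ n ih =>
    rw [sum_range_succ, ih, sum_range_succ, abelTerm, partialSum_succ]
    ring

end DirichletCharacter

lemma Complex.norm_natCast_cpow_sub_le {s : ℂ} (hs : 0 < s.re) (n : ℕ) :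
    ‖((n + 1 : ℕ) : ℂ) ^ (-s) - ((n + 2 : ℕ) : ℂ) ^ (-s)‖ ≤
      ‖s‖ * ((n + 1 : ℕ) : ℝ) ^ (-s.re - 1) := by
  have hs0 : s ≠ 0 := by rintro rfl; simp at hs
  have hpos : (0 : ℝ) < n + 1 := by positivity
  have key := norm_image_sub_le_of_norm_deriv_le_segment' (f := fun x : ℝ ↦ (x : ℂ) ^ (-s))
    (f' := fun x : ℝ ↦ -s * (x : ℂ) ^ (-s - 1)) (a := (n + 1 : ℝ)) (b := (n + 2 : ℝ))
    (C := ‖s‖ * ((n + 1 : ℕ) : ℝ) ^ (-s.re - 1)) ?_ ?_ (n + 2) ⟨by linarith, le_rfl⟩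
  · rw [norm_sub_rev]
    norm_num at key ⊢
    exact key
  · intro x hx
    have hx0 : x ≠ 0 := by linarith [hx.1]
    exact (hasDerivAt_ofReal_cpow_const hx0 (neg_ne_zero.mpr hs0)).hasDerivWithinAt
  · intro x hx
    have hx0 : 0 < x := by linarith [hx.1]
    rw [norm_mul, norm_neg, norm_cpow_eq_rpow_re_of_pos hx0]
    gcongr
    simp only [sub_re, neg_re, one_re]
    push_cast
    exact Real.rpow_le_rpow_of_nonpos hpos hx.1 (by linarith)

namespace DirichletCharacter

variable {N : ℕ} [NeZero N]

lemma norm_abelTerm_le {χ : DirichletCharacter ℂ N} (hχ : χ ≠ 1) {s : ℂ} (hs : 0 < s.re) (n : ℕ) :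
    ‖χ.abelTerm n s‖ ≤ N * (‖s‖ * ((n + 1 : ℕ) : ℝ) ^ (-s.re - 1)) := by
  rw [abelTerm, norm_mul]
  gcongr
  · exact norm_partialSum_le_level hχ _
  · exact norm_natCast_cpow_sub_le hs n

lemma summable_succ_rpow {a : ℝ} (ha : a < -1) :
    Summable fun n : ℕ ↦ ((n + 1 : ℕ) : ℝ) ^ a :=
  (summable_nat_add_iff 1).mpr (Real.summable_nat_rpow.mpr ha)

lemma summable_abelTerm {χ : DirichletCharacter ℂ N} (hχ : χ ≠ 1) {s : ℂ} (hs : 0 < s.re) :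
    Summable fun n ↦ χ.abelTerm n s :=
  Summable.of_norm_bounded
    (((summable_succ_rpow (by linarith : -s.re - 1 < -1)).mul_left _).mul_left _)
    (norm_abelTerm_le hχ hs)

lemma tendsto_sum_tsum_abelTerm {χ : DirichletCharacter ℂ N} (hχ : χ ≠ 1) {s : ℂ}
    (hs : 0 < s.re) :
    Tendsto (fun n ↦ ∑ k ∈ range n, χ ((k + 1 : ℕ) : ZMod N) * ((k + 1 : ℕ) : ℂ) ^ (-s)) atTop
      (𝓝 (∑' n, χ.abelTerm n s)) := by
  simp_rw [sum_range_eq_sum_abelTerm]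
  rw [← add_zero (∑' n, χ.abelTerm n s)]
  refine (summable_abelTerm hχ hs).hasSum.tendsto_sum_nat.add ?_
  have h0 : Tendsto (fun n : ℕ ↦ (N : ℝ) * ((n + 1 : ℕ) : ℝ) ^ (-s.re)) atTop (𝓝 0) := by
    rw [← mul_zero (N : ℝ)]
    refine Tendsto.const_mul _ ?_
    exact (tendsto_rpow_neg_atTop hs).comp
      (tendsto_natCast_atTop_atTop.comp (tendsto_add_atTop_nat 1))
  refine squeeze_zero_norm (fun n ↦ ?_) h0
  rw [norm_mul, norm_natCast_cpow_of_pos (Nat.succ_pos n), neg_re]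
  gcongr
  exact norm_partialSum_le_level hχ _

lemma differentiableOn_tsum_abelTerm {χ : DirichletCharacter ℂ N} (hχ : χ ≠ 1) :
    DifferentiableOn ℂ (fun s ↦ ∑' n, χ.abelTerm n s) {s | 0 < s.re} := by
  intro s hs
  have hs : 0 < s.re := hs
  set U : Set ℂ := {w | s.re / 2 < w.re} ∩ Metric.ball 0 (‖s‖ + 1) with hU
  have hUo : IsOpen U := (isOpen_lt continuous_const continuous_re).inter Metric.isOpen_ball
  have hsU : s ∈ U := ⟨by simp; linarith, by simp⟩
  refine DifferentiableAt.differentiableWithinAt ?_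
  refine DifferentiableOn.differentiableAt (s := U) ?_ (hUo.mem_nhds hsU)
  refine differentiableOn_tsum_of_summable_norm
    (u := fun n ↦ N * ((‖s‖ + 1) * ((n + 1 : ℕ) : ℝ) ^ (-(s.re / 2) - 1)))
    (((summable_succ_rpow (by linarith)).mul_left _).mul_left _) ?_ hUo ?_
  · intro i
    have h1 : ((i + 1 : ℕ) : ℂ) ≠ 0 := by exact_mod_cast Nat.succ_ne_zero i
    have h2 : ((i + 2 : ℕ) : ℂ) ≠ 0 := by exact_mod_cast Nat.succ_ne_zero (i + 1)
    refine Differentiable.differentiableOn ?_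
    unfold abelTerm
    exact (((differentiable_id.neg).const_cpow (.inl h1)).sub
      ((differentiable_id.neg).const_cpow (.inl h2))).const_mul _
  · intro i w hw
    have h1 : s.re / 2 < w.re := hw.1
    have h2 : ‖w‖ < ‖s‖ + 1 := by simpa using hw.2
    refine (norm_abelTerm_le hχ (by linarith) i).trans ?_
    gcongr
    · exact_mod_cast Nat.succ_le_succ (Nat.zero_le i)

lemma LFunction_eq_tsum_abelTerm {χ : DirichletCharacter ℂ N} (hχ : χ ≠ 1) {s : ℂ}
    (hs : 0 < s.re) : LFunction χ s = ∑' n, χ.abelTerm n s := by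
  have hopen : IsOpen {s : ℂ | 0 < s.re} := isOpen_lt continuous_const continuous_re
  have hconn : IsPreconnected {s : ℂ | 0 < s.re} := (convex_halfSpace_re_gt 0).isPreconnected
  refine AnalyticOnNhd.eqOn_of_preconnected_of_eventuallyEq (𝕜 := ℂ)
    ((differentiable_LFunction hχ).differentiableOn.analyticOnNhd hopen)
    ((differentiableOn_tsum_abelTerm hχ).analyticOnNhd hopen) hconn
    (z₀ := 2) (by simp) ?_ hs
  have hnhds : {s : ℂ | 1 < s.re} ∈ 𝓝 (2 : ℂ) :=
    (isOpen_lt continuous_const continuous_re).mem_nhds (by simp)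
  filter_upwards [hnhds] with w hw
  have hw : 1 < w.re := hw
  rw [LFunction_eq_LSeries χ hw]
  have hsum : LSeriesSummable (χ ·) w :=
    LSeriesSummable_of_bounded_of_one_lt_re (m := 1) (fun n _ ↦ χ.norm_le_one _) hw
  have ht := (hsum.hasSum.tendsto_sum_nat).comp (tendsto_add_atTop_nat 1)
  refine tendsto_nhds_unique ht ?_
  refine (tendsto_sum_tsum_abelTerm hχ (by linarith : 0 < w.re)).congr fun n ↦ ?_
  simp only [Function.comp]
  rw [sum_range_succ']
  simp [LSeries.term, cpow_neg, div_eq_mul_inv]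

end DirichletCharacter

end

section

open ArithmeticFunction hiding log
open Filter Topology Finset Complex

namespace DirichletCharacter

variable {N : ℕ} [NeZero N]

lemma exists_norm_LFunction_le : ∃ K : ℝ, 1 ≤ K ∧ ∀ (N : ℕ) [NeZero N]
    (χ : DirichletCharacter ℂ N), χ ≠ 1 → ∀ s ∈ Metric.closedBall (2 : ℂ) (3 / 2),
      ‖LFunction χ s‖ ≤ K * N := by
  have hsum : Summable fun n : ℕ ↦ ((n + 1 : ℕ) : ℝ) ^ (-(1 / 2) - 1 : ℝ) :=
    summable_succ_rpow (by norm_num)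
  refine ⟨max 1 (4 * ∑' n : ℕ, ((n + 1 : ℕ) : ℝ) ^ (-(1 / 2) - 1 : ℝ)), le_max_left _ _, ?_⟩
  intro N _ χ hχ s hs
  have hs' : ‖s - 2‖ ≤ 3 / 2 := by simpa [dist_eq_norm] using hs
  have hre : 1 / 2 ≤ s.re := by
    have := (abs_le.mp ((abs_re_le_norm (s - 2)).trans hs')).1
    simp at this
    linarith
  have hnorm : ‖s‖ ≤ 4 := by
    have := norm_add_le (s - 2) 2
    rw [sub_add_cancel] at this
    norm_num at this
    linarith
  rw [LFunction_eq_tsum_abelTerm hχ (by linarith)]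
  have key : ‖∑' n, χ.abelTerm n s‖ ≤
      ∑' n : ℕ, (N : ℝ) * (4 * ((n + 1 : ℕ) : ℝ) ^ (-(1 / 2) - 1 : ℝ)) := by
    refine tsum_of_norm_bounded ((hsum.mul_left 4).mul_left (N : ℝ)).hasSum fun n ↦ ?_
    refine (norm_abelTerm_le hχ (by linarith) n).trans ?_
    gcongr
    exact_mod_cast Nat.succ_le_succ (Nat.zero_le n)
  refine key.trans ?_
  rw [tsum_mul_left, tsum_mul_left, mul_comm]
  gcongr
  exact le_max_right _ _

lemma exists_norm_LFunction_one_le {δ : ℝ} (hδ : 0 < δ) (hδ1 : δ < 1) :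
    ∃ K : ℝ, 0 < K ∧ ∀ (N : ℕ) [NeZero N] (χ : DirichletCharacter ℂ N), χ ≠ 1 →
      ‖LFunction χ 1‖ ≤ K * (N : ℝ) ^ δ := by
  have hsum : Summable fun n : ℕ ↦ ((n + 1 : ℕ) : ℝ) ^ (-1 - δ) :=
    summable_succ_rpow (by linarith)
  refine ⟨∑' n : ℕ, ((n + 1 : ℕ) : ℝ) ^ (-1 - δ),
    hsum.tsum_pos (fun n ↦ by positivity) 0 (by positivity), ?_⟩
  intro N _ χ hχ
  rw [LFunction_eq_tsum_abelTerm hχ (by simp), mul_comm, ← tsum_mul_left]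
  refine tsum_of_norm_bounded (hsum.mul_left _).hasSum fun n ↦ ?_
  rw [abelTerm, norm_mul]
  have h1 : ‖χ.partialSum (n + 1)‖ ≤ (N : ℝ) ^ δ * ((n + 1 : ℕ) : ℝ) ^ (1 - δ) := by
    calc ‖χ.partialSum (n + 1)‖ =
          ‖χ.partialSum (n + 1)‖ ^ δ * ‖χ.partialSum (n + 1)‖ ^ (1 - δ) := by
          rw [← Real.rpow_add_of_nonneg (norm_nonneg _) hδ.le (by linarith)]
          simp
      _ ≤ _ := by
        gcongr
        · exact norm_partialSum_le_level hχ _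
        · exact norm_partialSum_le _ _
  have h2 := norm_natCast_cpow_sub_le (s := 1) (by simp) n
  refine (mul_le_mul h1 h2 (norm_nonneg _) (by positivity)).trans ?_
  rw [mul_assoc]
  gcongr
  rw [norm_one, one_mul, ← Real.rpow_add (by positivity)]
  apply le_of_eq
  congr 1
  simp only [one_re]
  ring

open scoped ComplexConjugate in
lemma conj_LFunction_ofReal {χ : DirichletCharacter ℂ N} (hχ : χ ≠ 1) (hχ2 : χ ^ 2 = 1) {x : ℝ}
    (hx : 0 < x) : conj (LFunction χ x) = LFunction χ x := by
  have hval : ∀ a, conj (χ a) = χ a := by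
    intro a
    rcases MulChar.isQuadratic_iff_sq_eq_one.mpr hχ2 a with h | h | h <;> simp [h]
  have hpow : ∀ n : ℕ, conj (((n : ℕ) : ℂ) ^ (-(x : ℂ))) = ((n : ℕ) : ℂ) ^ (-(x : ℂ)) := by
    intro n
    rw [← ofReal_neg, ← ofReal_natCast, ← ofReal_cpow (Nat.cast_nonneg n), conj_ofReal]
  rw [LFunction_eq_tsum_abelTerm hχ (by simpa using hx), conj_tsum]
  congr 1 with n
  simp only [abelTerm, partialSum, map_mul, map_sum, map_sub, hval, hpow]

lemma LSeriesSummable_toArithmeticFunction (χ : DirichletCharacter ℂ N) {s : ℂ} (hs : 1 < s.re) :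
    LSeriesSummable (toArithmeticFunction (χ ·) ·) s :=
  (LSeriesSummable_congr _ fun h ↦ (χ.apply_eq_toArithmeticFunction_apply h).symm).mpr <|
    ZMod.LSeriesSummable_of_one_lt_re χ hs

lemma LSeries_toArithmeticFunction (χ : DirichletCharacter ℂ N) {s : ℂ} (hs : 1 < s.re) :
    LSeries (toArithmeticFunction (χ ·) ·) s = LFunction χ s := by
  rw [LFunction_eq_LSeries χ hs]
  exact LSeries_congr (fun hn ↦ (χ.apply_eq_toArithmeticFunction_apply hn).symm) s

lemma LSeries_natCoe_zeta {s : ℂ} (hs : 1 < s.re) :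
    LSeries ((.zeta : ArithmeticFunction ℂ) ·) s = riemannZeta s := by
  simp_rw [natCoe_apply]
  exact LSeries_zeta_eq_riemannZeta hs

lemma LSeriesSummable_natCoe_zeta {s : ℂ} (hs : 1 < s.re) :
    LSeriesSummable ((.zeta : ArithmeticFunction ℂ) ·) s := by
  simp_rw [natCoe_apply]
  exact LSeriesSummable_zeta_iff.mpr hs

lemma LSeries_zetaMul (χ : DirichletCharacter ℂ N) {s : ℂ} (hs : 1 < s.re) :
    LSeries χ.zetaMul s = riemannZeta s * LFunction χ s := by
  have h := LSeries_mul' (LSeriesSummable_natCoe_zeta hs)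
    (χ.LSeriesSummable_toArithmeticFunction hs)
  rw [LSeries_natCoe_zeta hs, χ.LSeries_toArithmeticFunction hs] at h
  exact h

open scoped ComplexOrder in
lemma re_LFunction_one_pos {χ : DirichletCharacter ℂ N} (hχ : χ ≠ 1) (hχ2 : χ ^ 2 = 1) :
    0 < (LFunction χ 1).re := by
  have him : (LFunction χ 1).im = 0 := by
    have := conj_LFunction_ofReal hχ hχ2 one_pos
    rw [ofReal_one] at this
    exact conj_eq_iff_im.mp this
  have hge : ∀ x : ℝ, 1 < x → 0 ≤ (LFunction χ x).re := by
    intro x hx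
    have hx' : 1 < (x : ℂ).re := by simpa
    have h1 : 0 < LSeries (1 : ℕ → ℂ) x :=
      LSeries.positive (fun _ ↦ zero_le_one) zero_lt_one
        (by
          rw [show (fun _ ↦ (1 : ℂ)) = (1 : ℕ → ℂ) from rfl, LSeries.abscissaOfAbsConv_one]
          exact_mod_cast hx)
    rw [LSeries_one_eq_riemannZeta hx'] at h1
    have h2 : 0 ≤ LSeries χ.zetaMul x :=
      tsum_nonneg fun n ↦ LSeries.term_nonneg (zetaMul_nonneg hχ2 n) x
    rw [LSeries_zetaMul χ hx'] at h2
    rw [Complex.pos_iff] at h1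
    have h3 := (Complex.nonneg_iff.mp h2).1
    rw [mul_re, ← h1.2, zero_mul, sub_zero] at h3
    exact nonneg_of_mul_nonneg_right h3 h1.1
  have hlim : Tendsto (fun x : ℝ ↦ (LFunction χ x).re) (𝓝[>] 1) (𝓝 (LFunction χ 1).re) := by
    have hc : Continuous fun x : ℝ ↦ (LFunction χ x).re :=
      continuous_re.comp ((differentiable_LFunction hχ).continuous.comp continuous_ofReal)
    simpa using (hc.tendsto 1).mono_left nhdsWithin_le_nhds
  have h0 : 0 ≤ (LFunction χ 1).re :=
    ge_of_tendsto hlim (eventually_nhdsWithin_of_forall fun x hx ↦ hge x hx)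
  refine h0.lt_of_ne fun h ↦ LFunction_apply_one_ne_zero hχ ?_
  exact Complex.ext h.symm him

end DirichletCharacter

end

section

open ArithmeticFunction hiding log
open Filter Topology Finset Complex

namespace DirichletCharacter

variable {M N K : ℕ}

/-- The Dirichlet convolution of `1`, `χ`, `ψ` and `θ`, for use when `θ = χ ψ`. -/
noncomputable def biquadratic (χ : DirichletCharacter ℂ M) (ψ : DirichletCharacter ℂ N)
    (θ : DirichletCharacter ℂ K) : ArithmeticFunction ℂ :=
  χ.zetaMul * (toArithmeticFunction (ψ ·) * toArithmeticFunction (θ ·))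

variable {χ : DirichletCharacter ℂ M} {ψ : DirichletCharacter ℂ N} {θ : DirichletCharacter ℂ K}

lemma biquadratic_comm : biquadratic χ ψ θ = biquadratic ψ χ θ := by
  simp only [biquadratic, zetaMul]
  ring

lemma toArithmeticFunction_mul_apply (hθ : ∀ n : ℕ, θ n = χ n * ψ n) (n : ℕ) :
    (toArithmeticFunction (ψ ·) * toArithmeticFunction (θ ·)) n = ψ n * χ.zetaMul n := by
  rw [zetaMul, ArithmeticFunction.mul_apply, ArithmeticFunction.mul_apply, mul_sum]
  refine sum_congr rfl fun x hx ↦ ?_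
  obtain ⟨h, hn⟩ := Nat.mem_divisorsAntidiagonal.mp hx
  have h1 : x.1 ≠ 0 := by rintro h0; simp [h0] at h; exact hn h.symm
  have h2 : x.2 ≠ 0 := by rintro h0; simp [h0] at h; exact hn h.symm
  rw [← apply_eq_toArithmeticFunction_apply _ h1, ← apply_eq_toArithmeticFunction_apply _ h2,
    ← apply_eq_toArithmeticFunction_apply _ h2, natCoe_apply, zeta_apply_ne h1, hθ, ← h]
  simp
  ring

lemma isMultiplicative_biquadratic : (biquadratic χ ψ θ).IsMultiplicative :=
  χ.isMultiplicative_zetaMul.mul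
    ((isMultiplicative_toArithmeticFunction ψ).mul (isMultiplicative_toArithmeticFunction θ))

open scoped ComplexOrder

lemma biquadratic_prime_pow_nonneg_of_nonneg (hχ : χ ^ 2 = 1) (hθ : ∀ n : ℕ, θ n = χ n * ψ n)
    {p : ℕ} (hp : p.Prime) (h : ∀ k, 0 ≤ ψ (p : ZMod N) ^ k * χ.zetaMul (p ^ k)) (k : ℕ) :
    0 ≤ biquadratic χ ψ θ (p ^ k) := by
  rw [biquadratic, ArithmeticFunction.mul_apply]
  refine sum_nonneg fun x hx ↦ mul_nonneg (zetaMul_nonneg hχ _) ?_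
  obtain ⟨j, -, hj⟩ := (Nat.dvd_prime_pow hp).mp
    (Dvd.intro_left _ (Nat.mem_divisorsAntidiagonal.mp hx).1)
  rw [toArithmeticFunction_mul_apply hθ, hj]
  simpa using h j

lemma zetaMul_prime_pow_of_eq_neg_one {p : ℕ} (hp : p.Prime) (h : χ (p : ZMod M) = -1) (k : ℕ) :
    χ.zetaMul (p ^ k) = if _root_.Even k then 1 else 0 := by
  have h1 : χ.zetaMul (p ^ k) = ∑ i ∈ (p ^ k).divisors, toArithmeticFunction (χ ·) i :=
    coe_zeta_mul_apply
  have h2 : ∀ i, toArithmeticFunction (χ ·) (p ^ i) = (-1) ^ i := fun i ↦ by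
    rw [← apply_eq_toArithmeticFunction_apply _ (pow_ne_zero i hp.ne_zero), Nat.cast_pow,
      map_pow, h]
  rw [h1, Nat.sum_divisors_prime_pow hp, sum_congr rfl fun i _ ↦ h2 i, neg_one_geom_sum]
  by_cases hk : _root_.Even k <;> simp [hk, Nat.even_add_one]

lemma biquadratic_prime_pow_nonneg (hχ : χ ^ 2 = 1) (hψ : ψ ^ 2 = 1)
    (hθ : ∀ n : ℕ, θ n = χ n * ψ n) {p : ℕ} (hp : p.Prime) (k : ℕ) :
    0 ≤ biquadratic χ ψ θ (p ^ k) := by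
  have hpos : 0 ≤ ψ (p : ZMod N) → 0 ≤ biquadratic χ ψ θ (p ^ k) := fun h ↦
    biquadratic_prime_pow_nonneg_of_nonneg hχ hθ hp
      (fun j ↦ mul_nonneg (pow_nonneg h j) (zetaMul_nonneg hχ _)) k
  rcases MulChar.isQuadratic_iff_sq_eq_one.mpr hψ p with h | h | h
  · exact hpos h.ge
  · exact hpos (h ▸ zero_le_one)
  · rw [biquadratic_comm]
    refine biquadratic_prime_pow_nonneg_of_nonneg hψ (fun n ↦ by rw [hθ, mul_comm]) hp
      (fun j ↦ ?_) k
    rw [zetaMul_prime_pow_of_eq_neg_one hp h]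
    split_ifs with hj
    · obtain ⟨i, rfl⟩ := hj
      rcases MulChar.isQuadratic_iff_sq_eq_one.mpr hχ p with h | h | h <;> rw [h, mul_one]
      · exact pow_nonneg le_rfl _
      · simp
      · simp [← two_mul, pow_mul]
    · simp

lemma biquadratic_nonneg (hχ : χ ^ 2 = 1) (hψ : ψ ^ 2 = 1) (hθ : ∀ n : ℕ, θ n = χ n * ψ n)
    (n : ℕ) : 0 ≤ biquadratic χ ψ θ n := by
  rcases eq_or_ne n 0 with rfl | hn
  · simp
  · rw [isMultiplicative_biquadratic.multiplicative_factorization _ hn]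
    exact prod_nonneg fun p hp ↦
      biquadratic_prime_pow_nonneg hχ hψ hθ (Nat.prime_of_mem_primeFactors hp) _

variable [NeZero N] [NeZero K] in
lemma LSeriesSummable_biquadratic {s : ℂ} (hs : 1 < s.re) :
    LSeriesSummable (biquadratic χ ψ θ ·) s :=
  ArithmeticFunction.LSeriesSummable_mul (χ.LSeriesSummable_zetaMul hs) <|
    ArithmeticFunction.LSeriesSummable_mul (ψ.LSeriesSummable_toArithmeticFunction hs)
      (θ.LSeriesSummable_toArithmeticFunction hs)

variable [NeZero M] [NeZero N] [NeZero K] in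
lemma LSeries_biquadratic {s : ℂ} (hs : 1 < s.re) :
    LSeries (biquadratic χ ψ θ ·) s =
      riemannZeta s * (LFunction χ s * LFunction ψ s * LFunction θ s) := by
  have h1 := ArithmeticFunction.LSeries_mul' (χ.LSeriesSummable_zetaMul hs) <|
    ArithmeticFunction.LSeriesSummable_mul (ψ.LSeriesSummable_toArithmeticFunction hs)
      (θ.LSeriesSummable_toArithmeticFunction hs)
  have h2 := ArithmeticFunction.LSeries_mul' (ψ.LSeriesSummable_toArithmeticFunction hs)
      (θ.LSeriesSummable_toArithmeticFunction hs)
  rw [LSeries_zetaMul χ hs, h2, LSeries_toArithmeticFunction ψ hs,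
    LSeries_toArithmeticFunction θ hs] at h1
  rw [biquadratic, h1]
  ring

end DirichletCharacter

end

section

open Filter Topology Finset Complex

lemma hasSum_const_mul_geometric_tail (A : ℝ) (M : ℕ) :
    HasSum (fun m : ℕ ↦ A * (3 / 4 : ℝ) ^ (m + M)) (4 * A * (3 / 4) ^ M) := by
  have h1 := (hasSum_geometric_of_lt_one (r := (3 / 4 : ℝ)) (by norm_num) (by norm_num)).mul_left
    (A * (3 / 4) ^ M)
  have h2 : A * (3 / 4 : ℝ) ^ M * (1 - 3 / 4)⁻¹ = 4 * A * (3 / 4) ^ M := by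
    rw [show (1 - 3 / 4 : ℝ)⁻¹ = 4 by norm_num]
    ring
  have h3 : (fun m : ℕ ↦ A * (3 / 4 : ℝ) ^ (m + M)) =
      fun m ↦ A * (3 / 4) ^ M * (3 / 4) ^ m := by
    funext m
    rw [pow_add, mul_comm ((3 / 4 : ℝ) ^ m), mul_assoc]
  rwa [h3, ← h2]

lemma neg_le_of_hasSum_mul_pow {d : ℕ → ℝ} {A y v : ℝ} (hA : ∀ m, |d m| ≤ A * (2 / 3) ^ m)
    (hy : 0 ≤ y) (hy' : y ≤ 9 / 8) (h : HasSum (fun m ↦ d m * y ^ m) v) (M : ℕ) :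
    -(4 * A * (3 / 4) ^ M) ≤ v - ∑ m ∈ range M, d m * y ^ m := by
  have hA0 : 0 ≤ A := by simpa using (abs_nonneg _).trans (hA 0)
  have htail : ∀ m, -(A * (3 / 4) ^ m) ≤ d m * y ^ m := fun m ↦ by
    have h1 : |d m * y ^ m| ≤ A * (2 / 3) ^ m * (9 / 8) ^ m := by
      rw [abs_mul, abs_of_nonneg (a := y ^ m) (by positivity)]
      gcongr
      exact hA m
    rw [mul_assoc, ← mul_pow, show (2 / 3 * (9 / 8) : ℝ) = 3 / 4 by norm_num] at h1
    exact (abs_le.mp h1).1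
  exact hasSum_le (fun m ↦ htail (m + M)) (hasSum_const_mul_geometric_tail A M).neg
    ((hasSum_nat_add_iff' M).mpr h)

lemma sum_range_mul_pow_ge {d : ℕ → ℝ} {l y : ℝ} (hd0 : 1 - l ≤ d 0) (hd : ∀ m, -l ≤ d m)
    (hy : 0 ≤ y) (M : ℕ) :
    1 - l * ∑ m ∈ range (M + 1), y ^ m ≤ ∑ m ∈ range (M + 1), d m * y ^ m := by
  rw [sum_range_succ', sum_range_succ' (fun m ↦ d m * y ^ m), mul_add, mul_sum]
  have : ∑ m ∈ range M, -(l * y ^ (m + 1)) ≤ ∑ m ∈ range M, d (m + 1) * y ^ (m + 1) :=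
    sum_le_sum fun m _ ↦ by
      rw [← neg_mul]
      exact mul_le_mul_of_nonneg_right (hd _) (by positivity)
  rw [sum_neg_distrib] at this
  simp only [pow_zero, mul_one]
  linarith

lemma one_le_of_hasSum_mul_pow {d : ℕ → ℝ} {l A y v : ℝ} (hd0 : 1 - l ≤ d 0)
    (hd : ∀ m, -l ≤ d m) (hA : ∀ m, |d m| ≤ A * (2 / 3) ^ m) (hy : 1 < y)
    (hy' : y ≤ 9 / 8) (h : HasSum (fun m ↦ d m * y ^ m) v) (hv : v ≤ l / (y - 1)) (M : ℕ) :
    1 ≤ l * y ^ (M + 1) / (y - 1) + 4 * A * (3 / 4) ^ (M + 1) := by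
  have h2 := neg_le_of_hasSum_mul_pow hA (by linarith) hy' h (M + 1)
  have h3 := sum_range_mul_pow_ge hd0 hd (by linarith : 0 ≤ y) M
  rw [geom_sum_eq hy.ne', mul_div_assoc', mul_sub, mul_one, sub_div] at h3
  linarith

namespace Complex

/-- The entire function `(s - 1) ζ(s)`. -/
noncomputable def subOneMulZeta : ℂ → ℂ :=
  Function.update (fun s ↦ (s - 1) * riemannZeta s) 1 1

lemma subOneMulZeta_of_ne {s : ℂ} (hs : s ≠ 1) : subOneMulZeta s = (s - 1) * riemannZeta s :=
  Function.update_of_ne hs ..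

lemma subOneMulZeta_one : subOneMulZeta 1 = 1 := Function.update_self ..

lemma differentiable_subOneMulZeta : Differentiable ℂ subOneMulZeta := by
  have h : ∀ s ≠ 1, DifferentiableAt ℂ subOneMulZeta s := fun s hs ↦ by
    apply DifferentiableAt.congr_of_eventuallyEq
    · exact (differentiableAt_id.sub_const 1).mul (differentiableAt_riemannZeta hs)
    · filter_upwards [eventually_ne_nhds hs] with t ht using Function.update_of_ne ht ..
  intro s
  rcases ne_or_eq s 1 with hs | rfl
  · exact h s hs
  refine (analyticAt_of_differentiable_on_punctured_nhds_of_continuousAt ?_ ?_).differentiableAt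
  · filter_upwards [self_mem_nhdsWithin] with t ht using h t ht
  · simpa only [subOneMulZeta, continuousAt_update_same] using riemannZeta_residue_one

lemma exists_norm_subOneMulZeta_le :
    ∃ K : ℝ, 1 ≤ K ∧ ∀ s ∈ Metric.closedBall (2 : ℂ) (3 / 2), ‖subOneMulZeta s‖ ≤ K := by
  obtain ⟨K, hK⟩ := (isCompact_closedBall (2 : ℂ) (3 / 2)).exists_bound_of_continuousOn
    differentiable_subOneMulZeta.continuous.continuousOn
  exact ⟨max 1 K, le_max_left _ _, fun s hs ↦ (hK s hs).trans (le_max_right _ _)⟩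

/-- `ζ(s) g(s) - g(1) / (s - 1)`, as an entire function. -/
noncomputable def zetaMulSubPole (g : ℂ → ℂ) : ℂ → ℂ := dslope (subOneMulZeta * g) 1

variable {g : ℂ → ℂ}

lemma zetaMulSubPole_of_ne {s : ℂ} (hs : s ≠ 1) :
    zetaMulSubPole g s = riemannZeta s * g s - g 1 * (s - 1)⁻¹ := by
  have := sub_ne_zero.mpr hs
  rw [zetaMulSubPole, dslope_of_ne _ hs, slope_def_field, Pi.mul_apply, Pi.mul_apply,
    subOneMulZeta_one, subOneMulZeta_of_ne hs]
  field_simp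

lemma differentiable_zetaMulSubPole (hg : Differentiable ℂ g) :
    Differentiable ℂ (zetaMulSubPole g) :=
  differentiableOn_univ.mp <| (differentiableOn_dslope univ_mem).mpr
    (differentiable_subOneMulZeta.mul hg).differentiableOn

lemma norm_zetaMulSubPole_le {K B : ℝ}
    (hK : ∀ s ∈ Metric.closedBall (2 : ℂ) (3 / 2), ‖subOneMulZeta s‖ ≤ K)
    (hB : ∀ s ∈ Metric.closedBall (2 : ℂ) (3 / 2), ‖g s‖ ≤ B)
    {s : ℂ} (hs : s ∈ Metric.sphere (2 : ℂ) (3 / 2)) :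
    ‖zetaMulSubPole g s‖ ≤ 4 * K * B := by
  have h1 : (1 : ℂ) ∈ Metric.closedBall (2 : ℂ) (3 / 2) := by
    rw [Metric.mem_closedBall, dist_eq_norm]; norm_num
  have hs' := Metric.sphere_subset_closedBall hs
  have h : 1 / 2 ≤ ‖s - 1‖ := by
    have h2 : ‖s - 2‖ = 3 / 2 := by simpa [dist_eq_norm] using hs
    have h3 := norm_sub_norm_le (s - 2) (-1)
    rw [h2, norm_neg, norm_one] at h3
    calc _ ≤ _ := by linarith
      _ ≤ _ := h3
      _ = _ := by congr 1; ring
  have hne : s ≠ 1 := by rintro rfl; norm_num at h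
  have hK0 : 0 ≤ K := (norm_nonneg _).trans (hK _ h1)
  have hB0 : 0 ≤ B := (norm_nonneg _).trans (hB _ h1)
  have hKK : 1 ≤ K := by simpa [subOneMulZeta_one] using hK _ h1
  rw [zetaMulSubPole, dslope_of_ne _ hne, slope_def_field, norm_div, div_le_iff₀ (by linarith)]
  simp only [Pi.mul_apply, subOneMulZeta_one, one_mul]
  calc _ ≤ ‖subOneMulZeta s * g s‖ + ‖g 1‖ := norm_sub_le _ _
    _ ≤ K * B + 1 * B := by
      rw [norm_mul, one_mul]
      gcongr
      exacts [hK s hs', hB s hs', hB 1 h1]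
    _ ≤ K * B + K * B := by gcongr
    _ = 4 * K * B * (1 / 2) := by ring
    _ ≤ _ := by gcongr

lemma iteratedDeriv_sub_one_inv (m : ℕ) :
    iteratedDeriv m (fun s : ℂ ↦ (s - 1)⁻¹) 2 = (-1) ^ m * m.factorial := by
  rw [iteratedDeriv_comp_sub_const (f := fun s : ℂ ↦ s⁻¹), iteratedDeriv_eq_iterate]
  have := iter_deriv_inv m (2 - 1 : ℂ)
  norm_num at this ⊢

end Complex

open scoped ComplexOrder

lemma LSeries.one_le_of_nonneg {a : ℕ → ℂ} (ha : 0 ≤ a) (ha1 : a 1 = 1) {s : ℂ} (hs : s = 2)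
    (h : LSeriesSummable a s) : 1 ≤ LSeries a s := by
  have h1 : LSeries.term a s 1 = 1 := by simp [ha1]
  rw [← h1]
  refine h.le_tsum 1 fun n _ ↦ ?_
  subst hs
  rcases eq_or_ne n 0 with rfl | hn
  · simp
  · rw [LSeries.term_of_ne_zero hn, show (2 : ℂ) = (2 : ℕ) by simp, cpow_natCast]
    exact div_nonneg (ha n) (by exact_mod_cast Nat.zero_le _)

end

section

open Filter Topology Finset Complex
open scoped ComplexOrder

namespace Complex

variable {g : ℂ → ℂ} {a : ℕ → ℂ}

lemma iteratedDeriv_zetaMulSubPole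
    (heq : ∀ s : ℂ, 1 < s.re → LSeries a s = riemannZeta s * g s)
    (hd : ContDiffAt ℂ ⊤ (LSeries a) 2) (m : ℕ) :
    iteratedDeriv m (zetaMulSubPole g) 2 =
      iteratedDeriv m (LSeries a) 2 - g 1 * ((-1) ^ m * m.factorial) := by
  have h : zetaMulSubPole g =ᶠ[𝓝 2] fun s ↦ LSeries a s - g 1 * (s - 1)⁻¹ := by
    filter_upwards [continuous_re.continuousAt.eventually_mem
      (isOpen_Ioi.mem_nhds (by simp : (1 : ℝ) < (2 : ℂ).re))] with s hs
    rw [zetaMulSubPole_of_ne (by rintro rfl; simp at hs), heq s hs]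
  have h2 : ContDiffAt ℂ m (fun s : ℂ ↦ (s - 1)⁻¹) 2 :=
    (contDiffAt_id.sub contDiffAt_const).inv (by norm_num)
  rw [h.iteratedDeriv_eq, iteratedDeriv_fun_sub (hd.of_le le_top) (contDiffAt_const.mul h2),
    iteratedDeriv_const_mul_field, iteratedDeriv_sub_one_inv]

lemma exists_one_le_of_LSeries_eq_zeta_mul : ∃ K : ℝ, 1 ≤ K ∧ ∀ (g : ℂ → ℂ) (a : ℕ → ℂ)
    (l B x : ℝ), Differentiable ℂ g → 0 ≤ a → a 1 = 1 →
    (∀ s : ℂ, 1 < s.re → LSeriesSummable a s) →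
    (∀ s : ℂ, 1 < s.re → LSeries a s = riemannZeta s * g s) → g 1 = l →
    (∀ s ∈ Metric.closedBall (2 : ℂ) (3 / 2), ‖g s‖ ≤ B) →
    7 / 8 ≤ x → x < 1 → (riemannZeta x * g x).re ≤ 0 → ∀ M : ℕ,
      1 ≤ l * (2 - x) ^ (M + 1) / (1 - x) + 4 * (K * B) * (3 / 4) ^ (M + 1) := by
  obtain ⟨K, hK1, hK⟩ := exists_norm_subOneMulZeta_le
  refine ⟨4 * K, by linarith, fun g a l B x hg ha ha1 hsum heq hl hB hx hx1 hre M ↦ ?_⟩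
  have habs : LSeries.abscissaOfAbsConv a < ((2 : ℝ) : ℂ).re := by
    refine lt_of_le_of_lt (LSeries.abscissaOfAbsConv_le_of_forall_lt_LSeriesSummable (x := 1)
      fun y hy ↦ hsum y (by simpa using hy)) ?_
    rw [ofReal_re]
    exact_mod_cast (by norm_num : (1 : ℝ) < 2)
  have hd : ContDiffAt ℂ ⊤ (LSeries a) 2 :=
    ((LSeries_analyticOnNhd a) 2 (by simpa using habs)).contDiffAt
  have hF := differentiable_zetaMulSubPole hg
  have hc : ∀ m, ((m.factorial : ℂ)⁻¹ * ((-1) ^ m * iteratedDeriv m (zetaMulSubPole g) 2)) =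
      (m.factorial : ℂ)⁻¹ * ((-1) ^ m * iteratedDeriv m (LSeries a) (2 : ℝ)) - l := fun m ↦ by
    have h1 : (m.factorial : ℂ) ≠ 0 := mod_cast m.factorial_ne_zero
    rw [iteratedDeriv_zetaMulSubPole heq hd, hl, ofReal_ofNat, mul_sub, mul_sub,
      mul_left_comm _ (l : ℂ), ← mul_assoc ((-1) ^ m), ← mul_pow]
    field_simp
    norm_num
  have hpos : ∀ m, 0 ≤ (m.factorial : ℂ)⁻¹ * ((-1) ^ m * iteratedDeriv m (LSeries a) (2 : ℝ)) :=
    fun m ↦ mul_nonneg (by rw [← ofReal_natCast, ← ofReal_inv]; exact_mod_cast by positivity)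
      (LSeries.iteratedDeriv_alternating ha (by simpa using habs) m)
  have hA : ∀ m, ‖(m.factorial : ℂ)⁻¹ * ((-1) ^ m * iteratedDeriv m (zetaMulSubPole g) 2)‖ ≤
      4 * K * B * (2 / 3) ^ m := fun m ↦ by
    have h1 := norm_iteratedDeriv_le_of_forall_mem_sphere_norm_le m (c := 2) (R := 3 / 2)
      (by norm_num) hF.diffContOnCl (fun z hz ↦ norm_zetaMulSubPole_le hK hB hz)
    have h2 : (0 : ℝ) < m.factorial := mod_cast m.factorial_pos
    rw [norm_mul, norm_mul, norm_pow, norm_neg, norm_one, one_pow, one_mul, norm_inv,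
      Complex.norm_natCast, inv_mul_le_iff₀ h2]
    refine h1.trans_eq ?_
    rw [mul_div_assoc, div_eq_mul_inv, ← inv_pow]
    norm_num
  have hs := hasSum_taylorSeries_on_ball (c := 2) (r := 3 / 2) (z := x) hF.differentiableOn
    (by
      rw [Metric.mem_ball, dist_eq_norm, ← ofReal_ofNat, ← ofReal_sub, norm_real,
        Real.norm_eq_abs, abs_lt]
      constructor <;> linarith)
  have hs' := hasSum_re hs
  have hd' : ∀ m, ((m.factorial : ℂ)⁻¹ * ((-1) ^ m * iteratedDeriv m (zetaMulSubPole g) 2)).re *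
      (2 - x) ^ m =
      ((m.factorial : ℂ)⁻¹ • ((x : ℂ) - 2) ^ m • iteratedDeriv m (zetaMulSubPole g) 2).re :=
    fun m ↦ by
      rw [← re_mul_ofReal]
      congr 1
      push_cast
      rw [smul_eq_mul, smul_eq_mul, show ((x : ℂ) - 2) = (-1) * (2 - x) by ring, mul_pow]
      ring
  simp_rw [← hd'] at hs'
  have key := one_le_of_hasSum_mul_pow (l := l) (y := 2 - x) ?_ ?_ (fun m ↦
    (abs_re_le_norm _).trans (hA m)) (by linarith) (by linarith) hs' ?_ M
  · rwa [show 2 - x - 1 = 1 - x by ring] at key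
  · have := LSeries.one_le_of_nonneg ha ha1 (s := (2 : ℝ)) (by simp) (hsum _ (by simp))
    rw [hc, sub_re, ofReal_re]
    simp only [Nat.factorial_zero, Nat.cast_one, inv_one, pow_zero, one_mul, iteratedDeriv_zero]
    gcongr
    exact (le_def.mp this).1
  · intro m
    rw [hc, sub_re, ofReal_re]
    have := (le_def.mp (hpos m)).1
    rw [zero_re] at this
    linarith
  · have hne : (x : ℂ) ≠ 1 := by exact_mod_cast hx1.ne
    have h1 : (l : ℂ) * ((x : ℂ) - 1)⁻¹ = ((l * (x - 1)⁻¹ : ℝ) : ℂ) := by push_cast; rfl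
    rw [zetaMulSubPole_of_ne hne, sub_re, hl, h1, ofReal_re,
      show 2 - x - 1 = -(x - 1) by ring, div_neg, div_eq_mul_inv]
    linarith

/-- Estermann's lower bound for the residue at `1` of a Dirichlet series with nonnegative
coefficients. -/
lemma exists_mul_rpow_le_of_LSeries_eq_zeta_mul : ∃ c : ℝ, 0 < c ∧ ∀ (g : ℂ → ℂ) (a : ℕ → ℂ)
    (l B x : ℝ), Differentiable ℂ g → 0 ≤ a → a 1 = 1 →
    (∀ s : ℂ, 1 < s.re → LSeriesSummable a s) →
    (∀ s : ℂ, 1 < s.re → LSeries a s = riemannZeta s * g s) → g 1 = l → 0 ≤ l → 1 ≤ B →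
    (∀ s ∈ Metric.closedBall (2 : ℂ) (3 / 2), ‖g s‖ ≤ B) →
    7 / 8 ≤ x → x < 1 → (riemannZeta x * g x).re ≤ 0 →
      c * (1 - x) * B ^ (-(4 * (1 - x))) ≤ l := by
  obtain ⟨K, hK1, hK⟩ := exists_one_le_of_LSeries_eq_zeta_mul
  refine ⟨(2 * (Real.exp 2 * (8 * K) ^ (4 : ℝ)))⁻¹, by positivity,
    fun g a l B x hg ha ha1 hsum heq hl hl0 hB1 hB hx hx1 hre ↦ ?_⟩
  have hK8 : 1 ≤ 8 * (K * B) := by nlinarith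
  set t := 1 - x with ht
  have ht0 : 0 < t := by linarith
  have ht1 : 4 * t ≤ 1 := by linarith
  set n := ⌈Real.log (8 * (K * B)) * 4⌉₊ with hn
  have hlog0 : 0 ≤ Real.log (8 * (K * B)) := Real.log_nonneg hK8
  have hn1 : Real.log (8 * (K * B)) * 4 ≤ n := Nat.le_ceil _
  have hn2 : (n : ℝ) ≤ Real.log (8 * (K * B)) * 4 + 1 := (Nat.ceil_lt_add_one (by positivity)).le
  have h34 : Real.log (3 / 4) ≤ -(1 / 4) := by
    have := Real.log_le_sub_one_of_pos (x := 3 / 4) (by norm_num)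
    linarith
  have h1 : 4 * (K * B) * (3 / 4) ^ (n + 1) ≤ 1 / 2 := by
    have h2 : ((3 : ℝ) / 4) ^ (n + 1) ≤ (8 * (K * B))⁻¹ := by
      rw [← Real.log_le_log_iff (by positivity) (by positivity), Real.log_inv, Real.log_pow]
      push_cast
      nlinarith
    calc _ ≤ 4 * (K * B) * (8 * (K * B))⁻¹ := by gcongr
      _ = 1 / 2 := by field_simp; norm_num
  have h2 := hK g a l B x hg ha ha1 hsum heq hl hB hx hx1 hre n
  have h3 : (2 - x) ^ (n + 1) ≤ Real.exp 2 * (8 * K) ^ (4 : ℝ) * B ^ (4 * t) := by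
    calc (2 - x) ^ (n + 1) ≤ Real.exp t ^ (n + 1) := by
          gcongr
          · linarith
          · have := Real.add_one_le_exp t
            linarith
      _ = Real.exp ((n + 1) * t) := by rw [← Real.exp_nat_mul]; push_cast; rfl
      _ ≤ Real.exp (2 + Real.log (8 * (K * B)) * (4 * t)) := by
        gcongr
        nlinarith
      _ = Real.exp 2 * (8 * (K * B)) ^ (4 * t) := by
        rw [Real.exp_add, Real.rpow_def_of_pos (x := 8 * (K * B)) (by positivity)]
      _ = Real.exp 2 * (8 * K) ^ (4 * t) * B ^ (4 * t) := by
        rw [← mul_assoc 8, Real.mul_rpow (by positivity) (by positivity), mul_assoc]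
      _ ≤ _ := by
        gcongr
        · linarith
        · linarith
  have h4 : 1 / 2 ≤ l * (Real.exp 2 * (8 * K) ^ (4 : ℝ) * B ^ (4 * t)) / t := by
    calc _ ≤ l * (2 - x) ^ (n + 1) / t := by linarith
      _ ≤ _ := by gcongr
  rw [le_div_iff₀ ht0] at h4
  have hBpos : 0 < B ^ (4 * t) := by positivity
  rw [Real.rpow_neg (by positivity), ← div_eq_mul_inv, div_le_iff₀ hBpos, mul_comm,
    ← div_eq_mul_inv,
    div_le_iff₀ (by positivity)]
  linarith

end Complex

end

section

open Filter Topology Finset Complex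
open scoped ComplexOrder ComplexConjugate

namespace DirichletCharacter

variable {M N : ℕ} [NeZero M] [NeZero N]

lemma ofReal_re_LFunction {χ : DirichletCharacter ℂ N} (hχ : χ ≠ 1) (hχ2 : χ ^ 2 = 1) {x : ℝ}
    (hx : 0 < x) : ((LFunction χ x).re : ℂ) = LFunction χ x :=
  conj_eq_iff_re.mp (conj_LFunction_ofReal hχ hχ2 hx)

lemma ofReal_re_LFunction_one {χ : DirichletCharacter ℂ N} (hχ : χ ≠ 1) (hχ2 : χ ^ 2 = 1) :
    ((LFunction χ 1).re : ℂ) = LFunction χ 1 := by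
  simpa using ofReal_re_LFunction hχ hχ2 one_pos

lemma exists_mul_rpow_le_re_LFunction_one : ∃ c : ℝ, 0 < c ∧ ∀ (N : ℕ) [NeZero N]
    (χ : DirichletCharacter ℂ N), χ ≠ 1 → χ ^ 2 = 1 → ∀ x : ℝ, 7 / 8 ≤ x → x < 1 →
      (riemannZeta x * LFunction χ x).re ≤ 0 →
        c * (1 - x) * (N : ℝ) ^ (-(4 * (1 - x))) ≤ (LFunction χ 1).re := by
  obtain ⟨c, hc, hcore⟩ := exists_mul_rpow_le_of_LSeries_eq_zeta_mul
  obtain ⟨K, hK, hbd⟩ := exists_norm_LFunction_le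
  refine ⟨c * (K ^ (4 : ℝ))⁻¹, by positivity, fun N _ χ hχ hχ2 x hx hx1 hre ↦ ?_⟩
  have hN : (1 : ℝ) ≤ N := mod_cast NeZero.one_le
  have h := hcore (LFunction χ) χ.zetaMul (LFunction χ 1).re (K * N) x
    (differentiable_LFunction hχ) (fun n ↦ zetaMul_nonneg hχ2 n)
    χ.isMultiplicative_zetaMul.map_one (fun s hs ↦ χ.LSeriesSummable_zetaMul hs)
    (fun s hs ↦ LSeries_zetaMul χ hs) (ofReal_re_LFunction_one hχ hχ2).symm
    (re_LFunction_one_pos hχ hχ2).le (by nlinarith) (hbd N χ hχ) hx hx1 hre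
  refine le_trans ?_ h
  rw [Real.mul_rpow (by positivity) (by positivity),
    Real.rpow_neg (by positivity) (y := 4 * (1 - x)) (x := K)]
  have h1 : K ^ (4 * (1 - x)) ≤ K ^ (4 : ℝ) := Real.rpow_le_rpow_of_exponent_le hK (by linarith)
  have h2 : 0 ≤ 1 - x := by linarith
  calc c * (K ^ (4 : ℝ))⁻¹ * (1 - x) * (N : ℝ) ^ (-(4 * (1 - x)))
      = c * (1 - x) * ((K ^ (4 : ℝ))⁻¹ * (N : ℝ) ^ (-(4 * (1 - x)))) := by ring
    _ ≤ _ := by gcongr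

/-- The product of two Dirichlet characters, at the product of the levels. -/
noncomputable def mulLevel (χ : DirichletCharacter ℂ M) (ψ : DirichletCharacter ℂ N) :
    DirichletCharacter ℂ (M * N) :=
  changeLevel (dvd_mul_right M N) χ * changeLevel (dvd_mul_left N M) ψ

omit [NeZero M] [NeZero N] in
lemma mulLevel_sq {χ : DirichletCharacter ℂ M} {ψ : DirichletCharacter ℂ N} (hχ : χ ^ 2 = 1)
    (hψ : ψ ^ 2 = 1) : mulLevel χ ψ ^ 2 = 1 := by
  rw [mulLevel, mul_pow, ← map_pow, ← map_pow, hχ, hψ, map_one, map_one, mul_one]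

omit [NeZero M] [NeZero N] in
lemma mulLevel_natCast (χ : DirichletCharacter ℂ M) (ψ : DirichletCharacter ℂ N) (n : ℕ) :
    mulLevel χ ψ n = χ n * ψ n := by
  by_cases h : n.Coprime (M * N)
  · have hu : IsUnit ((n : ℕ) : ZMod (M * N)) := (ZMod.isUnit_iff_coprime n _).mpr h
    have h1 := changeLevel_eq_cast_of_dvd χ (dvd_mul_right M N) hu.unit
    have h2 := changeLevel_eq_cast_of_dvd ψ (dvd_mul_left N M) hu.unit
    rw [IsUnit.unit_spec, ZMod.cast_natCast (dvd_mul_right M N)] at h1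
    rw [IsUnit.unit_spec, ZMod.cast_natCast (dvd_mul_left N M)] at h2
    rw [mulLevel, MulChar.mul_apply, h1, h2]
  · have hu : ¬ IsUnit ((n : ℕ) : ZMod (M * N)) := mt (ZMod.isUnit_iff_coprime n _).mp h
    rw [MulChar.map_nonunit _ hu]
    rw [Nat.coprime_mul_iff_right, not_and_or] at h
    rcases h with h | h
    · rw [MulChar.map_nonunit χ (mt (ZMod.isUnit_iff_coprime n _).mp h), zero_mul]
    · rw [MulChar.map_nonunit ψ (mt (ZMod.isUnit_iff_coprime n _).mp h), mul_zero]

omit [NeZero N] in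
lemma mulLevel_ne_one {χ : DirichletCharacter ℂ M} {ψ : DirichletCharacter ℂ N} (hχ : χ ≠ 1)
    (h : M.Coprime N) : mulLevel χ ψ ≠ 1 := by
  intro h1
  obtain ⟨a, ha⟩ := MulChar.ne_one_iff.mp hχ
  obtain ⟨n, hn1, hn2⟩ := Nat.chineseRemainder h (a : ZMod M).val 1
  have hna : (n : ZMod M) = a := by
    rw [(ZMod.natCast_eq_natCast_iff n _ M).mpr hn1, ZMod.natCast_zmod_val]
  have hn1 : (n : ZMod N) = 1 := by
    rw [(ZMod.natCast_eq_natCast_iff n 1 N).mpr hn2, Nat.cast_one]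
  have h2 := mulLevel_natCast χ ψ n
  rw [hna, hn1, map_one, mul_one, h1] at h2
  refine ha (h2.symm.trans (MulChar.one_apply ?_))
  rw [ZMod.isUnit_iff_coprime, Nat.coprime_mul_iff_right, ← ZMod.isUnit_iff_coprime,
    ← ZMod.isUnit_iff_coprime, hna, hn1]
  exact ⟨a.isUnit, isUnit_one⟩

lemma exists_mul_rpow_le_of_LFunction_eq_zero : ∃ c : ℝ, 0 < c ∧ ∀ (M N : ℕ) [NeZero M] [NeZero N]
    (χ : DirichletCharacter ℂ M) (ψ : DirichletCharacter ℂ N), χ ≠ 1 → χ ^ 2 = 1 → ψ ≠ 1 →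
    ψ ^ 2 = 1 → M.Coprime N → ∀ x : ℝ, 7 / 8 ≤ x → x < 1 → LFunction χ x = 0 →
      c * (1 - x) * ((M * N : ℕ) : ℝ) ^ (-(8 * (1 - x))) ≤
        (LFunction χ 1).re * (LFunction ψ 1).re * (LFunction (mulLevel χ ψ) 1).re := by
  obtain ⟨c, hc, hcore⟩ := exists_mul_rpow_le_of_LSeries_eq_zeta_mul
  obtain ⟨K, hK, hbd⟩ := exists_norm_LFunction_le
  refine ⟨c * ((K ^ 3) ^ (4 : ℝ))⁻¹, by positivity,
    fun M N _ _ χ ψ hχ hχ2 hψ hψ2 hMN x hx hx1 hzero ↦ ?_⟩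
  set θ := mulLevel χ ψ
  have hθ : θ ≠ 1 := mulLevel_ne_one hχ hMN
  have hθ2 : θ ^ 2 = 1 := mulLevel_sq hχ2 hψ2
  have hN : (1 : ℝ) ≤ (M * N : ℕ) := mod_cast NeZero.one_le
  have hK3 : (1 : ℝ) ≤ K ^ 3 := one_le_pow₀ hK
  have h := hcore (fun s ↦ LFunction χ s * LFunction ψ s * LFunction θ s) (biquadratic χ ψ θ)
    ((LFunction χ 1).re * (LFunction ψ 1).re * (LFunction θ 1).re)
    (K ^ 3 * ((M * N : ℕ) : ℝ) ^ 2) x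
    (((differentiable_LFunction hχ).mul (differentiable_LFunction hψ)).mul
      (differentiable_LFunction hθ))
    (fun n ↦ biquadratic_nonneg hχ2 hψ2 (mulLevel_natCast χ ψ) n)
    isMultiplicative_biquadratic.map_one (fun s hs ↦ LSeriesSummable_biquadratic hs)
    (fun s hs ↦ LSeries_biquadratic hs) ?_ ?_ (by nlinarith) ?_ hx hx1 (by simp [hzero])
  · refine le_trans ?_ h
    rw [Real.mul_rpow (by positivity) (by positivity),
      Real.rpow_neg (by positivity) (y := 4 * (1 - x)) (x := K ^ 3), ← Real.rpow_natCast _ 2,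
      ← Real.rpow_mul (by positivity)]
    have h1 : (K ^ 3) ^ (4 * (1 - x)) ≤ (K ^ 3) ^ (4 : ℝ) :=
      Real.rpow_le_rpow_of_exponent_le hK3 (by linarith)
    have h2 : 0 ≤ 1 - x := by linarith
    rw [show ((2 : ℕ) : ℝ) * -(4 * (1 - x)) = -(8 * (1 - x)) by push_cast; ring]
    calc c * ((K ^ 3) ^ (4 : ℝ))⁻¹ * (1 - x) * ((M * N : ℕ) : ℝ) ^ (-(8 * (1 - x)))
        = c * (1 - x) * (((K ^ 3) ^ (4 : ℝ))⁻¹ * ((M * N : ℕ) : ℝ) ^ (-(8 * (1 - x)))) := by ring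
      _ ≤ _ := by gcongr
  · push_cast
    rw [ofReal_re_LFunction_one hχ hχ2, ofReal_re_LFunction_one hψ hψ2,
      ofReal_re_LFunction_one hθ hθ2]
  · exact mul_nonneg (mul_nonneg (re_LFunction_one_pos hχ hχ2).le (re_LFunction_one_pos hψ hψ2).le)
      (re_LFunction_one_pos hθ hθ2).le
  · intro s hs
    rw [norm_mul, norm_mul]
    calc _ ≤ (K * M) * (K * N) * (K * (M * N : ℕ)) := by
          gcongr
          exacts [hbd M χ hχ s hs, hbd N ψ hψ s hs, hbd (M * N) θ hθ s hs]
      _ = _ := by push_cast; ring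

end DirichletCharacter

lemma exists_re_riemannZeta_neg {t : ℝ} (ht : 0 < t) :
    ∃ y : ℝ, 1 - t ≤ y ∧ y < 1 ∧ ∀ x : ℝ, y ≤ x → x < 1 → (riemannZeta x).re < 0 := by
  have h1 : ∀ᶠ s in 𝓝[≠] (1 : ℂ), 0 < ((s - 1) * riemannZeta s).re :=
    ((continuous_re.tendsto _).comp riemannZeta_residue_one).eventually_const_lt (by simp)
  have h2 : Tendsto (fun x : ℝ ↦ (x : ℂ)) (𝓝[<] 1) (𝓝[≠] (1 : ℂ)) :=
    tendsto_nhdsWithin_iff.mpr ⟨(continuous_ofReal.tendsto' 1 1 (by simp)).mono_left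
      nhdsWithin_le_nhds, by
        filter_upwards [self_mem_nhdsWithin] with x hx
        simpa using (ne_of_lt hx : x ≠ 1)⟩
  obtain ⟨y, hy, h3⟩ := mem_nhdsLT_iff_exists_Ioo_subset.mp (h2.eventually h1)
  have hy1 : y < 1 := hy
  refine ⟨max (1 - t) ((y + 1) / 2), le_max_left _ _, by rw [max_lt_iff]; constructor <;> linarith,
    fun x hx hx1 ↦ ?_⟩
  have h4 : 0 < (((x : ℂ) - 1) * riemannZeta x).re :=
    h3 ⟨by linarith [(le_max_right _ _).trans hx], hx1⟩
  rw [show (x : ℂ) - 1 = ((x - 1 : ℝ) : ℂ) by push_cast; rfl, re_ofReal_mul] at h4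
  nlinarith

namespace DirichletCharacter

lemma re_LFunction_pos_of_ne_zero {N : ℕ} [NeZero N] {χ : DirichletCharacter ℂ N} (hχ : χ ≠ 1)
    (hχ2 : χ ^ 2 = 1) {y : ℝ} (hy0 : 0 < y) (hy1 : y < 1)
    (h : ∀ x : ℝ, y ≤ x → x < 1 → LFunction χ x ≠ 0) : 0 < (LFunction χ y).re := by
  by_contra! hneg
  have hcont : Continuous fun x : ℝ ↦ (LFunction χ x).re :=
    continuous_re.comp ((differentiable_LFunction hχ).continuous.comp continuous_ofReal)
  have hpos := re_LFunction_one_pos hχ hχ2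
  obtain ⟨x, hx, hx0⟩ := intermediate_value_Icc hy1.le hcont.continuousOn
    (Set.mem_Icc.mpr ⟨hneg, by simpa using hpos.le⟩)
  have hx1 : x ≠ 1 := by
    rintro rfl
    simp only [ofReal_one] at hx0
    exact hpos.ne' hx0
  refine h x hx.1 (lt_of_le_of_ne hx.2 hx1) ?_
  rw [← ofReal_re_LFunction hχ hχ2 (by linarith [hx.1])]
  simp only at hx0
  rw [hx0, ofReal_zero]

/-- Siegel's theorem, for quadratic characters of pairwise coprime levels. -/
theorem exists_mul_rpow_le_re_LFunction_one_of_coprime {ι : Type*} (level : ι → ℕ)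
    [∀ i, NeZero (level i)] (χ : ∀ i, DirichletCharacter ℂ (level i)) (hχ : ∀ i, χ i ≠ 1)
    (hχ2 : ∀ i, χ i ^ 2 = 1) (hco : ∀ i j, i ≠ j → (level i).Coprime (level j))
    {ε : ℝ} (hε : 0 < ε) (hε1 : ε < 1) :
    ∃ C : ℝ, 0 < C ∧ ∀ i, C * (level i : ℝ) ^ (-ε) ≤ (LFunction (χ i) 1).re := by
  obtain ⟨y, hy, hy1, hζ⟩ := exists_re_riemannZeta_neg (t := ε / 16) (by positivity)
  have hlev : ∀ i, (1 : ℝ) ≤ level i := fun i ↦ mod_cast NeZero.one_le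
  by_cases hz : ∃ i, ∃ x : ℝ, y ≤ x ∧ x < 1 ∧ LFunction (χ i) x = 0
  · obtain ⟨i, x, hx, hx1, hzero⟩ := hz
    obtain ⟨c, hc, h⟩ := exists_mul_rpow_le_of_LFunction_eq_zero
    obtain ⟨K, hK, hup⟩ := exists_norm_LFunction_one_le (half_pos hε) (by linarith)
    have hi := re_LFunction_one_pos (hχ i) (hχ2 i)
    have hx0 : 0 < 1 - x := by linarith
    set D := c * (1 - x) * (level i : ℝ) ^ (-ε) / ((LFunction (χ i) 1).re * K) with hD
    have hli := hlev i
    have hD0 : 0 < D := by positivity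
    refine ⟨min (LFunction (χ i) 1).re D, lt_min hi hD0, fun j ↦ ?_⟩
    have hlj := hlev j
    rcases eq_or_ne i j with rfl | hij
    · calc _ ≤ (LFunction (χ i) 1).re * 1 := by
            gcongr
            · exact min_le_left _ _
            · exact Real.rpow_le_one_of_one_le_of_nonpos hli (by linarith)
        _ = _ := mul_one _
    · have h1 := h _ _ (χ i) (χ j) (hχ i) (hχ2 i) (hχ j) (hχ2 j) (hco i j hij) x (by linarith) hx1
        hzero
      have h2 := (le_abs_self _).trans ((abs_re_le_norm _).trans
        (hup _ _ (mulLevel_ne_one (ψ := χ j) (hχ i) (hco i j hij))))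
      have hj := re_LFunction_one_pos (hχ j) (hχ2 j)
      set L := ((level i * level j : ℕ) : ℝ) with hL
      have hL1 : 1 ≤ L := by rw [hL]; push_cast; nlinarith
      have h3 : c * (1 - x) * L ^ (-(8 * (1 - x))) ≤
          (LFunction (χ i) 1).re * (LFunction (χ j) 1).re * (K * L ^ (ε / 2)) := by
        refine h1.trans ?_
        gcongr
      have h4 : c * (1 - x) * L ^ (-ε) ≤ (LFunction (χ i) 1).re * (LFunction (χ j) 1).re * K := by
        have h5 : 0 < L ^ (ε / 2) := by positivity
        refine le_of_mul_le_mul_right ?_ h5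
        calc c * (1 - x) * L ^ (-ε) * L ^ (ε / 2) = c * (1 - x) * L ^ (-(ε / 2)) := by
              rw [mul_assoc, ← Real.rpow_add (by linarith)]
              ring_nf
          _ ≤ c * (1 - x) * L ^ (-(8 * (1 - x))) := by
              gcongr 1
              exact Real.rpow_le_rpow_of_exponent_le hL1 (by linarith)
          _ ≤ _ := h3
          _ = _ := by ring
      calc _ ≤ D * (level j : ℝ) ^ (-ε) := by gcongr; exact min_le_right _ _
        _ ≤ _ := by
          rw [hD, div_mul_eq_mul_div, div_le_iff₀ (by positivity), mul_assoc,
            ← Real.mul_rpow (by linarith) (by linarith)]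
          rw [hL] at h4
          push_cast at h4
          linarith
  · push Not at hz
    obtain ⟨c, hc, h⟩ := exists_mul_rpow_le_re_LFunction_one
    have hy0 : 0 < 1 - y := by linarith
    refine ⟨c * (1 - y), by positivity, fun i ↦ ?_⟩
    have hpos := re_LFunction_pos_of_ne_zero (hχ i) (hχ2 i) (by linarith) hy1 (hz i)
    refine le_trans ?_ (h _ (χ i) (hχ i) (hχ2 i) y (by linarith) hy1 ?_)
    · gcongr 1
      exact Real.rpow_le_rpow_of_exponent_le (hlev i) (by linarith)
    · rw [← ofReal_re_LFunction (hχ i) (hχ2 i) (by linarith), re_mul_ofReal]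
      nlinarith [hζ y le_rfl hy1]

end DirichletCharacter

end

section

open Finset

namespace Polynomial

variable {R : Type*} [CommRing R]

/-- The operator `f ↦ X * f'`. -/
noncomputable def eulerOp : R[X] →ₗ[R] R[X] := (LinearMap.mulLeft R X).comp derivative

lemma eulerOp_apply (f : R[X]) : eulerOp f = X * derivative f := rfl

lemma eval_one_eulerOp_iterate_X_sub_one_pow_mul (n : ℕ) (f : R[X]) :
    eval 1 (eulerOp^[n] ((X - 1) ^ n * f)) = n.factorial * eval 1 f := by
  induction n generalizing f with
  | zero => simp
  | succ n ih =>
    have h : eulerOp ((X - 1) ^ (n + 1) * f) =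
        (X - 1) ^ n * (((n + 1 : ℕ) : R[X]) * X * f + (X - 1) * X * derivative f) := by
      simp only [eulerOp_apply, derivative_mul, derivative_pow, derivative_sub, derivative_X,
        derivative_one, Nat.add_sub_cancel, map_natCast]
      ring
    rw [Function.iterate_succ_apply, h, ih]
    simp [Nat.factorial_succ]
    ring

lemma eulerOp_iterate_pow (n : ℕ) (c : R) (j : ℕ) :
    eulerOp^[n] (C c * X ^ j) = C (c * (j : R) ^ n) * X ^ j := by
  induction n with
  | zero => simp
  | succ n ih =>
    rw [Function.iterate_succ_apply', ih, eulerOp_apply, derivative_C_mul_X_pow]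
    rcases j with _ | j
    · simp
    · simp only [Nat.add_sub_cancel, map_mul, map_pow, map_natCast]
      ring

lemma eulerOp_iterate_sum {ι : Type*} (n : ℕ) (s : Finset ι) (f : ι → R[X]) :
    eulerOp^[n] (∑ i ∈ s, f i) = ∑ i ∈ s, eulerOp^[n] (f i) := by
  simp [← Module.End.pow_apply]

lemma eulerOp_iterate_sub (n : ℕ) (f g : R[X]) :
    eulerOp^[n] (f - g) = eulerOp^[n] f - eulerOp^[n] g := by
  simp [← Module.End.pow_apply]

lemma eulerOp_iterate_C_mul (n : ℕ) (c : R) (g : R[X]) :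
    eulerOp^[n] (C c * g) = C c * eulerOp^[n] g := by
  simp only [← Module.End.pow_apply, ← smul_eq_C_mul, map_smul]

lemma exists_X_sub_one_mul_eq (f : R[X]) (hf : eval 1 f = 0) :
    ∃ q, f = (X - 1) * q ∧ eval 1 q = eval 1 (derivative f) := by
  obtain ⟨q, hq⟩ := dvd_iff_isRoot.mpr (show IsRoot f 1 from hf)
  rw [C_1] at hq
  exact ⟨q, hq, by simp [hq]⟩

end Polynomial

lemma IsPrimitiveRoot.prod_range_one_sub_pow_mul {R : Type*} [CommRing R] [IsDomain R] {m : ℕ}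
    {μ : R} (hμ : IsPrimitiveRoot μ (2 * m + 1)) :
    ∏ i ∈ range m, (1 - μ ^ (i + 1)) * (1 - μ ^ (2 * m + 1 - (i + 1))) = (2 * m + 1 : ℕ) := by
  have h : ∏ i ∈ range m, (1 - μ ^ (2 * m + 1 - (i + 1))) =
      ∏ i ∈ range m, (1 - μ ^ (m + i + 1)) := by
    rw [← prod_range_reflect]
    refine prod_congr rfl fun i hi ↦ ?_
    have := mem_range.mp hi
    congr 2; omega
  rw [prod_mul_distrib, h, ← prod_range_add (fun i ↦ 1 - μ ^ (i + 1)), ← two_mul,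
    hμ.prod_one_sub_pow_eq_order]
  push_cast; ring

lemma ZMod.factorial_half_sq {p m : ℕ} [Fact p.Prime] (hp : p = 2 * m + 1) (hm : Odd m) :
    ((m.factorial : ZMod p)) ^ 2 = 1 := by
  have h := ZMod.wilsons_lemma p
  have h2 : p - 1 = m + m := by omega
  rw [h2, ← prod_range_add_one_eq_factorial, prod_range_add, Nat.cast_mul,
    ← prod_range_reflect (fun i ↦ m + i + 1)] at h
  have h3 : ((∏ j ∈ range m, (m + (m - 1 - j) + 1) : ℕ) : ZMod p) =
      - ((∏ j ∈ range m, (j + 1) : ℕ) : ZMod p) := by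
    have : -((∏ j ∈ range m, (j + 1) : ℕ) : ZMod p) =
        (-1) ^ #(range m) * ((∏ j ∈ range m, (j + 1) : ℕ) : ZMod p) := by
      simp [hm.neg_one_pow]
    rw [this, Nat.cast_prod, Nat.cast_prod, ← prod_const, ← prod_mul_distrib]
    refine prod_congr rfl fun j hj ↦ ?_
    have := mem_range.mp hj
    have h4 : m + (m - 1 - j) + 1 = p - (j + 1) := by omega
    rw [h4, Nat.cast_sub (by omega)]
    simp
  rw [h3, prod_range_add_one_eq_factorial] at h
  linear_combination -h

end

section

open Finset Polynomial

section

variable {p m : ℕ} [Fact p.Prime]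

lemma ZMod.two_pow_half_eq_one (hp : p = 2 * m + 1) (h8 : p % 8 = 7) : (2 : ZMod p) ^ m = 1 := by
  have hm : p / 2 = m := by omega
  have h2 : p ≠ 2 := by omega
  rw [← hm, ← ZMod.euler_criterion p, ZMod.exists_sq_eq_two_iff h2]
  · exact Or.inr h8
  · rw [← Nat.cast_ofNat, Ne, ZMod.natCast_eq_zero_iff]
    intro h
    have := Nat.le_of_dvd two_pos h
    omega

lemma ZMod.sum_range_quadraticChar_mul_pow_half (hp : p = 2 * m + 1) (h0 : 0 < m) :
    ∑ j ∈ range p, ((quadraticChar (ZMod p) j : ℤ) : ZMod p) * (j : ZMod p) ^ m = -1 := by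
  rw [DirichletCharacter.sum_range_natCast_zmod
    (fun a : ZMod p ↦ ((quadraticChar (ZMod p) a : ℤ) : ZMod p) * a ^ m)]
  have h2 : ringChar (ZMod p) ≠ 2 := by rw [ZMod.ringChar_zmod_n]; omega
  have hm : Fintype.card (ZMod p) / 2 = m := by rw [ZMod.card]; omega
  have h (a : ZMod p) : ((quadraticChar (ZMod p) a : ℤ) : ZMod p) * a ^ m = a ^ (p - 1) := by
    rw [quadraticChar_eq_pow_of_char_ne_two' h2, hm, ← pow_add]
    congr 1; omega
  simp only [h]
  have := FiniteField.sum_pow_units (ZMod p) (p - 1)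
  rw [ZMod.card, if_pos dvd_rfl] at this
  rw [← this, ← sum_erase_add _ _ (mem_univ (0 : ZMod p)), zero_pow (by omega), add_zero]
  symm
  refine sum_bij (fun u _ ↦ (u : ZMod p)) (by simp) (fun _ _ _ _ h ↦ Units.ext h) ?_ (by simp)
  intro b hb
  exact ⟨Units.mk0 b (by simpa using hb), by simp⟩

variable (p) in
/-- The polynomial with value the quadratic Gauss sum at a primitive root of unity. -/
noncomputable def gaussPoly (R : Type*) [CommRing R] : R[X] :=
  ∑ j ∈ range p, C ((quadraticChar (ZMod p) j : ℤ) : R) * X ^ j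

variable (p) in
/-- The polynomial with value `√±p` at a primitive root of unity. -/
noncomputable def gaussProd (R : Type*) [CommRing R] (m : ℕ) : R[X] :=
  ∏ i ∈ range m, (X ^ (i + 1) - X ^ (p - (i + 1)))

lemma map_gaussPoly (R : Type*) [CommRing R] :
    (gaussPoly p ℤ).map (Int.castRingHom R) = gaussPoly p R := by
  simp [gaussPoly, Polynomial.map_sum]

omit [Fact p.Prime] in
lemma map_gaussProd (R : Type*) [CommRing R] :
    (gaussProd p ℤ m).map (Int.castRingHom R) = gaussProd p R m := by
  simp [gaussProd, Polynomial.map_prod]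

lemma eval_eulerOp_gaussPoly (hp : p = 2 * m + 1) (h0 : 0 < m) :
    eval 1 (eulerOp^[m] (gaussPoly p (ZMod p))) = -1 := by
  rw [gaussPoly, eulerOp_iterate_sum, eval_finsetSum,
    ← ZMod.sum_range_quadraticChar_mul_pow_half hp h0]
  simp only [eulerOp_iterate_pow, eval_mul, eval_C, eval_pow, eval_X, one_pow, mul_one]

lemma eval_eulerOp_gaussProd (hp : p = 2 * m + 1) (hm : Odd m) (h8 : p % 8 = 7) :
    eval 1 (eulerOp^[m] (gaussProd p (ZMod p) m)) = 1 := by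
  have h (i : ℕ) : ∃ q : (ZMod p)[X], X ^ (i + 1) - X ^ (p - (i + 1)) = (X - 1) * q ∧
      eval 1 q = eval 1 (derivative (X ^ (i + 1) - X ^ (p - (i + 1)) : (ZMod p)[X])) :=
    exists_X_sub_one_mul_eq _ (by simp)
  choose q hq hq1 using h
  have h1 : gaussProd p (ZMod p) m = (X - 1) ^ m * ∏ i ∈ range m, q i := by
    simp [gaussProd, hq, prod_mul_distrib]
  have h2 : ∀ i ∈ range m, eval 1 (q i) = 2 * ((i + 1 : ℕ) : ZMod p) := by
    intro i hi
    have := mem_range.mp hi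
    rw [hq1]
    simp only [derivative_sub, derivative_X_pow, eval_sub, eval_mul, eval_pow, eval_X, one_pow,
      map_natCast, eval_natCast, mul_one]
    rw [Nat.cast_sub (by omega), ZMod.natCast_self]
    ring
  rw [h1, eval_one_eulerOp_iterate_X_sub_one_pow_mul, eval_prod, prod_congr rfl h2,
    prod_mul_distrib, prod_const, card_range, ZMod.two_pow_half_eq_one hp h8, one_mul,
    ← Nat.cast_prod, prod_range_add_one_eq_factorial, ← sq, ZMod.factorial_half_sq hp hm]

lemma X_sub_one_pow_eq_map_cyclotomic :
    (cyclotomic p ℤ).map (Int.castRingHom (ZMod p)) = (X - 1) ^ (p - 1) := by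
  have h := cyclotomic_prime_mul_X_sub_one (ZMod p) p
  have h1 : (X - 1 : (ZMod p)[X]) ≠ 0 := X_sub_C_ne_zero 1
  rw [map_cyclotomic]
  refine mul_right_cancel₀ h1 ?_
  rw [h, ← pow_succ, Nat.sub_add_cancel (Fact.out : p.Prime).one_le, sub_pow_char, one_pow]

lemma intCast_eq_neg_one_of_aeval_gaussPoly (hp : p = 2 * m + 1) (hm : Odd m) (h8 : p % 8 = 7)
    {ζ : ℂ} (hζ : IsPrimitiveRoot ζ p) {e : ℤ}
    (h : aeval ζ (gaussPoly p ℤ) = e * aeval ζ (gaussProd p ℤ m)) : (e : ZMod p) = -1 := by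
  have hp0 : 0 < p := (Fact.out : p.Prime).pos
  have h0 : 0 < m := hm.pos
  have hdvd : cyclotomic p ℤ ∣ gaussPoly p ℤ - C e * gaussProd p ℤ m := by
    rw [cyclotomic_eq_minpoly hζ hp0]
    refine minpoly.isIntegrallyClosed_dvd (hζ.isIntegral hp0) ?_
    simp [h]
  have hdvd2 := map_dvd (Polynomial.mapRingHom (Int.castRingHom (ZMod p))) hdvd
  rw [coe_mapRingHom, X_sub_one_pow_eq_map_cyclotomic, Polynomial.map_sub, Polynomial.map_mul,
    map_gaussPoly, map_gaussProd, map_C, eq_intCast] at hdvd2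
  have hdvd3 : (X - 1 : (ZMod p)[X]) ^ (m + 1) ∣ _ :=
    (pow_dvd_pow _ (show m + 1 ≤ p - 1 by omega)).trans hdvd2
  obtain ⟨Q, hQ⟩ := hdvd3
  have h3 := congrArg (fun f ↦ eval 1 (eulerOp^[m] f)) hQ
  simp only [eulerOp_iterate_sub, eulerOp_iterate_C_mul, eval_sub, eval_mul, eval_C, pow_succ,
    mul_assoc, eval_one_eulerOp_iterate_X_sub_one_pow_mul, eval_eulerOp_gaussPoly hp h0,
    eval_eulerOp_gaussProd hp hm h8] at h3
  simp at h3
  linear_combination -h3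

end

end

section

open Finset Polynomial

section

variable {p m : ℕ} [Fact p.Prime]

variable (p) in
/-- The quadratic Dirichlet character modulo a prime. -/
noncomputable def quadDirichlet : DirichletCharacter ℂ p :=
  (quadraticChar (ZMod p)).ringHomComp (Int.castRingHom ℂ)

lemma quadDirichlet_apply (a : ZMod p) : quadDirichlet p a = ((quadraticChar (ZMod p) a : ℤ) : ℂ) :=
  rfl

lemma quadDirichlet_ne_one (h2 : p ≠ 2) : quadDirichlet p ≠ 1 :=
  (MulChar.ringHomComp_ne_one_iff Int.cast_injective).mpr
    (quadraticChar_ne_one (by rwa [ZMod.ringChar_zmod_n]))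

variable (p) in
lemma quadDirichlet_isQuadratic : (quadDirichlet p).IsQuadratic :=
  (quadraticChar_isQuadratic _).comp _

variable (p) in
lemma quadDirichlet_sq : quadDirichlet p ^ 2 = 1 :=
  (quadDirichlet_isQuadratic p).sq_eq_one

lemma quadDirichlet_neg_one (h8 : p % 8 = 7) : quadDirichlet p (-1) = -1 := by
  have h2 : ringChar (ZMod p) ≠ 2 := by rw [ZMod.ringChar_zmod_n]; omega
  rw [quadDirichlet_apply, quadraticChar_neg_one h2, ZMod.card, ZMod.χ₄_nat_eq_if_mod_four,
    if_neg (by omega), if_neg (by omega)]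
  simp

lemma quadDirichlet_two (h8 : p % 8 = 7) : quadDirichlet p 2 = 1 := by
  have h2 : ringChar (ZMod p) ≠ 2 := by rw [ZMod.ringChar_zmod_n]; omega
  rw [quadDirichlet_apply, quadraticChar_two h2, ZMod.card, ZMod.χ₈_nat_eq_if_mod_eight,
    if_neg (by omega), if_pos (by omega)]
  simp

lemma quadDirichlet_neg (h8 : p % 8 = 7) (a : ZMod p) :
    quadDirichlet p (-a) = -quadDirichlet p a := by
  rw [← neg_one_mul, map_mul, quadDirichlet_neg_one h8, neg_one_mul]

lemma quadDirichlet_two_mul (h8 : p % 8 = 7) (a : ZMod p) :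
    quadDirichlet p (2 * a) = quadDirichlet p a := by
  rw [map_mul, quadDirichlet_two h8, one_mul]

lemma isPrimitiveRoot_stdAddChar_one : IsPrimitiveRoot (ZMod.stdAddChar (1 : ZMod p) : ℂ) p := by
  have h := ZMod.stdAddChar_coe (N := p) 1
  simp only [Int.cast_one, mul_one] at h
  rw [h]
  exact Complex.isPrimitiveRoot_exp p (NeZero.ne p)

lemma stdAddChar_natCast (j : ℕ) :
    (ZMod.stdAddChar (j : ZMod p) : ℂ) = (ZMod.stdAddChar (1 : ZMod p) : ℂ) ^ j := by
  rw [← AddChar.map_nsmul_eq_pow, nsmul_one]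

lemma aeval_gaussPoly : aeval (ZMod.stdAddChar (1 : ZMod p) : ℂ) (gaussPoly p ℤ) =
    gaussSum (quadDirichlet p) ZMod.stdAddChar := by
  rw [gaussSum, ← DirichletCharacter.sum_range_natCast_zmod
    (fun a : ZMod p ↦ quadDirichlet p a * ZMod.stdAddChar a)]
  simp [gaussPoly, quadDirichlet_apply, stdAddChar_natCast, -quadraticChar_apply]

lemma gaussSum_quadDirichlet_sq (h8 : p % 8 = 7) :
    gaussSum (quadDirichlet p) (ZMod.stdAddChar (N := p)) ^ 2 = -p := by
  have h : quadDirichlet p ≠ 1 := quadDirichlet_ne_one (by omega)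
  rw [gaussSum_sq h (quadDirichlet_isQuadratic p) (ZMod.isPrimitive_stdAddChar p),
    quadDirichlet_neg_one h8, ZMod.card]
  ring

lemma aeval_gaussProd_sq (hp : p = 2 * m + 1) (hm : Odd m) {ζ : ℂ} (hζ : IsPrimitiveRoot ζ p) :
    (aeval ζ (gaussProd p ℤ m)) ^ 2 = -p := by
  have hμ : IsPrimitiveRoot (ζ ^ 2) p := hζ.pow_of_coprime 2
    ((Nat.coprime_primes Nat.prime_two Fact.out).mpr (by rintro rfl; omega))
  have h := (hp ▸ hμ).prod_range_one_sub_pow_mul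
  have h1 : ((-1 : ℂ)) ^ #(range m) = -1 := by simp [hm.neg_one_pow]
  have h2 : -(p : ℂ) = (-1) ^ #(range m) * ((2 * m + 1 : ℕ) : ℂ) := by rw [h1, ← hp]; ring
  rw [h2, ← h, gaussProd, map_prod, ← prod_pow, ← prod_const, ← prod_mul_distrib]
  refine prod_congr rfl fun i hi ↦ ?_
  have := mem_range.mp hi
  have h3 : ζ ^ (i + 1) * ζ ^ (p - (i + 1)) = 1 := by
    rw [← pow_add, ← hζ.pow_eq_one]; congr 1; omega
  simp only [map_sub, map_pow, aeval_X]
  rw [← hp, ← pow_mul, ← pow_mul, mul_comm 2, pow_mul, mul_comm 2, pow_mul]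
  linear_combination (ζ ^ (i + 1) * ζ ^ (p - (i + 1)) - 1) * h3

lemma exists_aeval_gaussProd_eq (hp : p = 2 * m + 1) (h4 : m % 4 = 3) :
    ∃ r : ℝ, 0 < r ∧
      aeval (ZMod.stdAddChar (1 : ZMod p) : ℂ) (gaussProd p ℤ m) = -Complex.I * r := by
  have hp0 : (0 : ℝ) < p := by exact_mod_cast (Fact.out : p.Prime).pos
  refine ⟨∏ i ∈ range m, (2 * Real.sin (2 * Real.pi * (i + 1 : ℕ) / p)), prod_pos fun i hi ↦ ?_, ?_⟩
  · have hi := mem_range.mp hi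
    have h1 : 2 * ((i + 1 : ℕ) : ℝ) < p := by exact_mod_cast (show 2 * (i + 1) < p by omega)
    refine mul_pos two_pos (Real.sin_pos_of_pos_of_lt_pi (by positivity) ?_)
    rw [div_lt_iff₀ hp0]
    nlinarith [Real.pi_pos]
  · have h1 : -Complex.I = Complex.I ^ #(range m) := by
      rw [card_range, ← Nat.div_add_mod m 4, h4, pow_add, pow_mul, Complex.I_pow_four, one_pow,
        Complex.I_pow_three, one_mul]
    rw [h1, gaussProd, map_prod, Complex.ofReal_prod, ← prod_const, ← prod_mul_distrib]
    refine prod_congr rfl fun i hi ↦ ?_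
    have hi := mem_range.mp hi
    simp only [map_sub, map_pow, aeval_X]
    rw [← stdAddChar_natCast, ← stdAddChar_natCast, Nat.cast_sub (by omega), ZMod.natCast_self,
      zero_sub]
    have h2 := ZMod.stdAddChar_coe (N := p) ((i + 1 : ℕ) : ℤ)
    have h3 := ZMod.stdAddChar_coe (N := p) (-((i + 1 : ℕ) : ℤ))
    rw [Int.cast_natCast] at h2
    rw [Int.cast_neg, Int.cast_natCast] at h3
    rw [h2, h3]
    have h4 := Complex.two_sin (2 * Real.pi * (i + 1 : ℕ) / p)
    push_cast at h4 ⊢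
    have h5 : 2 * (Real.pi : ℂ) * Complex.I * (i + 1) / p =
        2 * Real.pi * (i + 1) / p * Complex.I := by
      ring
    have h6 : 2 * (Real.pi : ℂ) * Complex.I * -(i + 1) / p =
        -(2 * Real.pi * (i + 1) / p) * Complex.I := by
      ring
    rw [h4, h5, h6]
    linear_combination (Complex.exp (2 * Real.pi * (i + 1) / p * Complex.I) -
      Complex.exp (-(2 * Real.pi * (i + 1) / p) * Complex.I)) * Complex.I_mul_I

lemma gaussSum_quadDirichlet (h8 : p % 8 = 7) :
    gaussSum (quadDirichlet p) (ZMod.stdAddChar (N := p)) = Complex.I * (√(p : ℝ) : ℝ) := by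
  obtain ⟨m, hp⟩ : ∃ m, p = 2 * m + 1 := ⟨p / 2, by omega⟩
  have hm : Odd m := Nat.odd_iff.mpr (by omega)
  have hζ := isPrimitiveRoot_stdAddChar_one (p := p)
  obtain ⟨r, hr0, hr⟩ := exists_aeval_gaussProd_eq hp (by omega)
  have hsq := aeval_gaussProd_sq hp hm hζ
  have hr2 : r = √(p : ℝ) := by
    rw [eq_comm, Real.sqrt_eq_iff_mul_self_eq (Nat.cast_nonneg p) hr0.le]
    rw [hr, mul_pow, neg_sq, Complex.I_sq] at hsq
    have : (p : ℂ) = (r : ℂ) * r := by linear_combination hsq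
    exact_mod_cast this
  have hτ := (sq_eq_sq_iff_eq_or_eq_neg).mp ((gaussSum_quadDirichlet_sq h8).trans hsq.symm)
  rcases hτ with h | h
  · have := intCast_eq_neg_one_of_aeval_gaussPoly hp hm h8 hζ (e := 1) (by
      rw [aeval_gaussPoly, h]; simp)
    rw [Int.cast_one, eq_comm] at this
    have : Fact (2 < p) := ⟨by omega⟩
    exact absurd ‹(-1 : ZMod p) = 1› ZMod.neg_one_ne_one
  · rw [h, hr, hr2]; ring

end

end

section

open Finset Filter Topology

section

variable {p : ℕ} [Fact p.Prime]

lemma one_sub_stdAddChar_natCast (k : ℕ) : (1 - ZMod.stdAddChar (k : ZMod p) : ℂ) =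
    (2 * Real.sin (Real.pi * k / p) : ℝ) * (Complex.cos ((Real.pi * k / p - Real.pi / 2 : ℝ)) +
      Complex.sin ((Real.pi * k / p - Real.pi / 2 : ℝ)) * Complex.I) := by
  have h := ZMod.stdAddChar_coe (N := p) (k : ℤ)
  rw [Int.cast_natCast] at h
  have h2 : 2 * (Real.pi : ℂ) * Complex.I * ((k : ℤ) : ℂ) / p =
      (2 * (Real.pi * k / p)) * Complex.I := by
    push_cast; ring
  rw [h, h2, Complex.exp_mul_I, Complex.cos_two_mul, Complex.sin_two_mul]
  push_cast
  rw [Complex.cos_sub_pi_div_two, Complex.sin_sub_pi_div_two]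
  linear_combination -2 * Complex.sin_sq_add_cos_sq (Real.pi * k / p)

lemma arg_one_sub_stdAddChar_natCast {k : ℕ} (h0 : 0 < k) (hk : k < p) :
    Complex.arg (1 - ZMod.stdAddChar (k : ZMod p) : ℂ) = Real.pi * k / p - Real.pi / 2 ∧
    (1 - ZMod.stdAddChar (k : ZMod p) : ℂ) ∈ Complex.slitPlane := by
  have hp0 : (0 : ℝ) < p := by exact_mod_cast h0.trans hk
  have hk0 : (0 : ℝ) < k := by exact_mod_cast h0
  have hpi := Real.pi_pos
  have h1 : 0 < Real.pi * k / p := by positivity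
  have h2 : Real.pi * k / p < Real.pi := by
    rw [div_lt_iff₀ hp0]
    exact mul_lt_mul_of_pos_left (by exact_mod_cast hk) hpi
  have hs : 0 < 2 * Real.sin (Real.pi * k / p) :=
    mul_pos two_pos (Real.sin_pos_of_pos_of_lt_pi h1 h2)
  have harg : Complex.arg (1 - ZMod.stdAddChar (k : ZMod p) : ℂ) =
      Real.pi * k / p - Real.pi / 2 := by
    rw [one_sub_stdAddChar_natCast]
    exact Complex.arg_mul_cos_add_sin_mul_I hs ⟨by linarith, by linarith⟩
  refine ⟨harg, Complex.mem_slitPlane_iff_arg.mpr ⟨?_, ?_⟩⟩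
  · rw [harg]
    exact ne_of_lt (by linarith)
  · rw [sub_ne_zero, Ne, eq_comm, ← AddChar.map_zero_eq_one (ZMod.stdAddChar (N := p)),
      ZMod.injective_stdAddChar.eq_iff, ZMod.natCast_eq_zero_iff]
    exact fun h ↦ absurd (Nat.le_of_dvd h0 h) (not_le.mpr hk)

lemma sum_quadDirichlet_mul_stdAddChar_pow (h2 : p ≠ 2) (n : ℕ) :
    ∑ k ∈ range p, quadDirichlet p k * (ZMod.stdAddChar (k : ZMod p) : ℂ) ^ n =
      quadDirichlet p n * gaussSum (quadDirichlet p) ZMod.stdAddChar := by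
  rw [DirichletCharacter.sum_range_natCast_zmod
    (fun a : ZMod p ↦ quadDirichlet p a * (ZMod.stdAddChar a : ℂ) ^ n)]
  have h (a : ZMod p) : (ZMod.stdAddChar a : ℂ) ^ n = ZMod.stdAddChar ((n : ZMod p) * a) := by
    rw [← AddChar.map_nsmul_eq_pow, nsmul_eq_mul]
  simp only [h]
  by_cases hn : (n : ZMod p) = 0
  · rw [hn]
    simp only [zero_mul, AddChar.map_zero_eq_one, mul_one]
    rw [MulChar.sum_eq_zero_of_ne_one (quadDirichlet_ne_one h2), MulChar.map_zero, zero_mul]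
  · have h1 := gaussSum_mulShift (quadDirichlet p) ZMod.stdAddChar (Units.mk0 _ hn)
    have hsq : quadDirichlet p n * quadDirichlet p n = 1 := by
      rw [quadDirichlet_apply, ← Int.cast_mul, ← sq, quadraticChar_sq_one hn, Int.cast_one]
    rw [← h1, Units.val_mk0, ← mul_assoc, hsq, one_mul]
    rfl

lemma tendsto_tsum_quadDirichlet_mul_pow (h2 : p ≠ 2) :
    Tendsto (fun z : ℂ ↦ ∑' n : ℕ, quadDirichlet p n / n * z ^ n)
      ((𝓝[<] (1 : ℝ)).map Complex.ofReal) (𝓝 ((quadDirichlet p).LFunction 1)) := by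
  have h1 : quadDirichlet p ≠ 1 := quadDirichlet_ne_one h2
  refine Complex.tendsto_tsum_powerSeries_nhdsWithin_lt ((tendsto_add_atTop_iff_nat 1).mp ?_)
  rw [DirichletCharacter.LFunction_eq_tsum_abelTerm h1 (by simp)]
  refine (DirichletCharacter.tendsto_sum_tsum_abelTerm h1 (by simp)).congr fun n ↦ ?_
  rw [sum_range_succ' _ n]
  simp [Complex.cpow_neg_one, div_eq_mul_inv]

lemma gaussSum_mul_LFunction_one (h2 : p ≠ 2) :
    gaussSum (quadDirichlet p) ZMod.stdAddChar * (quadDirichlet p).LFunction 1 =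
      -∑ k ∈ range p, quadDirichlet p k * Complex.log (1 - ZMod.stdAddChar (k : ZMod p)) := by
  have hL := (tendsto_map'_iff.mp (tendsto_tsum_quadDirichlet_mul_pow h2)).const_mul
    (gaussSum (quadDirichlet p) (ZMod.stdAddChar (N := p)))
  refine tendsto_nhds_unique hL ?_
  have hR : Tendsto (fun x : ℝ ↦ -∑ k ∈ range p,
      quadDirichlet p k * Complex.log (1 - x * ZMod.stdAddChar (k : ZMod p))) (𝓝[<] 1)
      (𝓝 (-∑ k ∈ range p,
        quadDirichlet p k * Complex.log (1 - ZMod.stdAddChar (k : ZMod p)))) := by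
    refine (tendsto_finsetSum _ fun k hk ↦ ?_).neg
    rcases Nat.eq_zero_or_pos k with rfl | hk0
    · have h0 : quadDirichlet p 0 = 0 := MulChar.map_zero _
      simp [h0]
    · refine Tendsto.const_mul _ (Tendsto.mono_left ?_ nhdsWithin_le_nhds)
      have h := (arg_one_sub_stdAddChar_natCast hk0 (mem_range.mp hk)).2
      have hc : ContinuousAt (fun x : ℝ ↦
          Complex.log (1 - x * ZMod.stdAddChar (k : ZMod p))) 1 := by
        refine ContinuousAt.clog (by fun_prop) (by simpa using h)
      simpa using hc.tendsto
  refine hR.congr' ?_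
  filter_upwards [Ioo_mem_nhdsLT (show (0 : ℝ) < 1 by norm_num)] with x hx
  have hsum (k : ℕ) : HasSum (fun n : ℕ ↦ quadDirichlet p k *
      ((x * ZMod.stdAddChar (k : ZMod p) : ℂ) ^ n / n))
      (quadDirichlet p k * -Complex.log (1 - x * ZMod.stdAddChar (k : ZMod p))) := by
    refine (Complex.hasSum_taylorSeries_neg_log ?_).mul_left _
    rw [norm_mul, AddChar.norm_apply, mul_one, Complex.norm_of_nonneg hx.1.le]
    exact hx.2
  have hs := (hasSum_sum fun k (_ : k ∈ range p) ↦ hsum k).tsum_eq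
  simp only [mul_neg, sum_neg_distrib] at hs
  rw [← hs, Function.comp_apply, ← tsum_mul_left]
  refine tsum_congr fun n ↦ ?_
  rw [show gaussSum (quadDirichlet p) (ZMod.stdAddChar (N := p)) *
    (quadDirichlet p n / n * (x : ℂ) ^ n) = quadDirichlet p n *
    gaussSum (quadDirichlet p) (ZMod.stdAddChar (N := p)) * ((x : ℂ) ^ n / n) by ring,
    ← sum_quadDirichlet_mul_stdAddChar_pow h2, sum_mul]
  refine sum_congr rfl fun k _ ↦ ?_
  rw [mul_pow]
  ring

lemma sqrt_mul_re_LFunction_one (h8 : p % 8 = 7) :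
    √(p : ℝ) * ((quadDirichlet p).LFunction 1).re =
      -(Real.pi / p) * (∑ k ∈ range p, quadraticChar (ZMod p) k * (k : ℤ) : ℤ) := by
  have h2 : p ≠ 2 := by omega
  have h := gaussSum_mul_LFunction_one h2
  rw [gaussSum_quadDirichlet h8] at h
  have him := congrArg Complex.im h
  have h1 : ∑ k ∈ range p, ((quadraticChar (ZMod p) k : ℤ) : ℝ) = 0 := by
    rw [DirichletCharacter.sum_range_natCast_zmod
      (fun a : ZMod p ↦ ((quadraticChar (ZMod p) a : ℤ) : ℝ)), ← Int.cast_sum,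
      quadraticChar_sum_zero (by rwa [ZMod.ringChar_zmod_n]), Int.cast_zero]
  have hterm : ∀ k ∈ range p,
      (quadDirichlet p k * Complex.log (1 - ZMod.stdAddChar (k : ZMod p))).im =
      Real.pi / p * ((quadraticChar (ZMod p) k : ℤ) * (k : ℝ)) -
        Real.pi / 2 * (quadraticChar (ZMod p) k : ℤ) := by
    intro k hk
    rcases Nat.eq_zero_or_pos k with rfl | hk0
    · simp
    · rw [quadDirichlet_apply, ← Complex.ofReal_intCast, Complex.im_ofReal_mul, Complex.log_im,
        (arg_one_sub_stdAddChar_natCast hk0 (mem_range.mp hk)).1]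
      ring
  rw [mul_comm Complex.I, mul_assoc, Complex.im_ofReal_mul, Complex.I_mul_im, Complex.neg_im,
    Complex.im_sum, sum_congr rfl hterm, sum_sub_distrib, ← mul_sum, ← mul_sum, h1] at him
  rw [him]
  push_cast
  ring

end

end

section

open Finset

section

lemma Finset.sum_range_two_mul {M : Type*} [AddCommMonoid M] (f : ℕ → M) (n : ℕ) :
    ∑ k ∈ range (2 * n), f k = ∑ k ∈ range n, f (2 * k) + ∑ k ∈ range n, f (2 * k + 1) := by
  induction n with
  | zero => simp
  | succ n ih =>
    rw [Nat.mul_succ, sum_range_succ, sum_range_succ, ih, sum_range_succ, sum_range_succ]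
    abel

variable {m t : ℕ} {c : ℕ → ℤ}

lemma sum_mul_eq_neg_mul_sum_half (h0 : c 0 = 0)
    (hneg : ∀ k ≤ 2 * m + 1, c (2 * m + 1 - k) = -c k) (h2 : ∀ k, c (2 * k) = c k) :
    ∑ k ∈ range (2 * m + 1), c k * (k : ℤ) = -(2 * m + 1) * ∑ k ∈ range (m + 1), c k := by
  have hS : ∑ k ∈ range (m + 1), c k = ∑ k ∈ range m, c (k + 1) := by
    rw [sum_range_succ', h0, add_zero]
  have hU : ∑ k ∈ range (m + 1), c k * (k : ℤ) = ∑ k ∈ range m, c (k + 1) * ((k + 1 : ℕ) : ℤ) := by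
    rw [sum_range_succ', h0, zero_mul, add_zero]
  have hT1 : ∑ k ∈ range (2 * m + 1), c k * (k : ℤ) =
      2 * ∑ k ∈ range (m + 1), c k * (k : ℤ) - (2 * m + 1) * ∑ k ∈ range (m + 1), c k := by
    rw [show 2 * m + 1 = (m + 1) + m by ring, sum_range_add, ← sum_range_reflect _ m, two_mul,
      add_sub_assoc]
    congr 1
    rw [hS, hU, mul_sum, ← sum_sub_distrib]
    refine sum_congr rfl fun k hk ↦ ?_
    have := mem_range.mp hk
    rw [show m + 1 + (m - 1 - k) = 2 * m + 1 - (k + 1) by omega, hneg _ (by omega),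
      Nat.cast_sub (by omega)]
    push_cast
    ring
  have hT2 : ∑ k ∈ range (2 * m + 1), c k * (k : ℤ) =
      4 * ∑ k ∈ range (m + 1), c k * (k : ℤ) - (2 * m + 1) * ∑ k ∈ range (m + 1), c k := by
    have h1 : ∑ k ∈ range m, c (2 * k + 1) * ((2 * k + 1 : ℕ) : ℤ) =
        2 * ∑ k ∈ range (m + 1), c k * (k : ℤ) - (2 * m + 1) * ∑ k ∈ range (m + 1), c k := by
      rw [← sum_range_reflect, hS, hU, mul_sum, mul_sum, ← sum_sub_distrib]
      refine sum_congr rfl fun k hk ↦ ?_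
      have := mem_range.mp hk
      rw [show 2 * (m - 1 - k) + 1 = 2 * m + 1 - 2 * (k + 1) by omega, hneg _ (by omega), h2,
        Nat.cast_sub (by omega)]
      push_cast
      ring
    have h3 : ∑ k ∈ range m, c (2 * k) * ((2 * k : ℕ) : ℤ) + c (2 * m) * ((2 * m : ℕ) : ℤ) =
        2 * ∑ k ∈ range (m + 1), c k * (k : ℤ) := by
      rw [← sum_range_succ (fun k ↦ c (2 * k) * ((2 * k : ℕ) : ℤ)), mul_sum]
      refine sum_congr rfl fun k _ ↦ ?_
      rw [h2]
      push_cast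
      ring
    rw [sum_range_succ, sum_range_two_mul, h1]
    linear_combination h3
  linear_combination 2 * hT1 - hT2

lemma sum_quarter_eq_sum_half (hneg : ∀ k ≤ 4 * t + 3, c (4 * t + 3 - k) = -c k)
    (h2 : ∀ k, c (2 * k) = c k) :
    ∑ k ∈ range (t + 1), c k = ∑ k ∈ range (2 * t + 2), c k := by
  have h1 : ∑ k ∈ range (2 * t + 2), c k =
      ∑ k ∈ range (t + 1), c k + ∑ k ∈ range (t + 1), c (2 * k + 1) := by
    rw [show 2 * t + 2 = 2 * (t + 1) by ring, sum_range_two_mul]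
    simp only [h2]
  have h3 : ∑ k ∈ range (2 * t + 2), c k =
      ∑ k ∈ range (t + 1), c k - ∑ k ∈ range (t + 1), c (2 * k + 1) := by
    rw [show 2 * t + 2 = (t + 1) + (t + 1) by ring, sum_range_add, sub_eq_add_neg,
      ← sum_neg_distrib, ← sum_range_reflect (fun k ↦ c (t + 1 + k))]
    congr 1
    refine sum_congr rfl fun k hk ↦ ?_
    have := mem_range.mp hk
    rw [← hneg _ (by omega), ← h2]
    congr 1; omega
  linarith

end

section

variable {p : ℕ} [Fact p.Prime]

lemma isQR_iff {a : ℕ} (ha : (a : ZMod p) ≠ 0) : IsQR p a ↔ quadraticChar (ZMod p) a = 1 := by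
  rw [quadraticChar_one_iff_isSquare ha, IsQR, isSquare_iff_exists_sq]
  constructor
  · rintro ⟨x, hx⟩
    refine ⟨x, ?_⟩
    have := (ZMod.intCast_eq_intCast_iff _ _ _).mpr hx
    push_cast at this
    exact this.symm
  · rintro ⟨y, hy⟩
    obtain ⟨x, rfl⟩ := ZMod.intCast_surjective y
    refine ⟨x, (ZMod.intCast_eq_intCast_iff _ _ _).mp ?_⟩
    push_cast
    exact hy.symm

lemma two_mul_Qcount_four_sub (h8 : p % 8 = 7) :
    2 * (Qcount p 4 : ℤ) - ((p - 1) / 4 : ℕ) =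
      ∑ k ∈ range ((p - 1) / 4 + 1), quadraticChar (ZMod p) k := by
  classical
  set t := (p - 1) / 4 with ht
  have hne {a : ℕ} (h0 : 0 < a) (h : a < p) : (a : ZMod p) ≠ 0 := by
    rw [Ne, ZMod.natCast_eq_zero_iff]
    exact fun hd ↦ absurd (Nat.le_of_dvd h0 hd) (not_le.mpr h)
  have h2 : ringChar (ZMod p) ≠ 2 := by rw [ZMod.ringChar_zmod_n]; omega
  have h4 (k : ℕ) (h : (k : ZMod p) ≠ 0) :
      quadraticChar (ZMod p) ((4 * k : ℕ) : ZMod p) = quadraticChar (ZMod p) k := by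
    have : ((2 : ℕ) : ZMod p) ≠ 0 := hne two_pos (by omega)
    rw [show ((4 * k : ℕ) : ZMod p) = ((2 : ℕ) : ZMod p) ^ 2 * k by push_cast; ring, map_mul,
      quadraticChar_sq_one' this, one_mul]
  have hcard : Qcount p 4 = #{k ∈ range t | quadraticChar (ZMod p) ((k + 1 : ℕ) : ZMod p) = 1} := by
    rw [← card_image_of_injective (f := fun k ↦ 4 * (k + 1)) _ fun a b h ↦ by simpa using h, Qcount]
    congr 1
    ext a
    simp only [mem_filter, mem_Icc, mem_image, mem_range]
    constructor
    · rintro ⟨⟨ha0, ha⟩, ⟨k, rfl⟩, hq⟩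
      rw [isQR_iff (hne ha0 (by omega)), h4 k (hne (by omega) (by omega))] at hq
      refine ⟨k - 1, ⟨by omega, ?_⟩, by omega⟩
      rwa [Nat.sub_add_cancel (by omega)]
    · rintro ⟨k, ⟨hk, hq⟩, rfl⟩
      refine ⟨by omega, Dvd.intro _ rfl, ?_⟩
      rwa [isQR_iff (hne (by omega) (by omega)), h4 _ (hne (by omega) (by omega))]
  rw [hcard, sum_range_succ', Nat.cast_zero, MulChar.map_zero, add_zero, card_filter]
  have : (t : ℤ) = ∑ k ∈ range t, 1 := by simp
  rw [this, Nat.cast_sum, mul_sum, ← sum_sub_distrib]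
  refine sum_congr rfl fun k hk ↦ ?_
  have := mem_range.mp hk
  rcases quadraticChar_dichotomy (hne (Nat.succ_pos k) (show k + 1 < p by omega)) with h | h
  · rw [h]; simp
  · rw [h]; simp

lemma Qcount_four_sub_eq (h8 : p % 8 = 7) :
    (Qcount p 4 : ℝ) - (((p - 1) / 4 : ℕ) : ℝ) / 2 =
      √(p : ℝ) * ((quadDirichlet p).LFunction 1).re / (2 * Real.pi) := by
  obtain ⟨t, hp⟩ : ∃ t, p = 4 * t + 3 := ⟨p / 4, by omega⟩
  have ht : (p - 1) / 4 = t := by omega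
  have h2p : ringChar (ZMod p) ≠ 2 := by rw [ZMod.ringChar_zmod_n]; omega
  have h2 (k : ℕ) : quadraticChar (ZMod p) ((2 * k : ℕ) : ZMod p) = quadraticChar (ZMod p) k := by
    have := quadDirichlet_two_mul h8 (k : ZMod p)
    rw [quadDirichlet_apply, quadDirichlet_apply] at this
    rw [Nat.cast_mul, Nat.cast_ofNat]
    exact_mod_cast this
  have hneg (k : ℕ) (hk : k ≤ p) :
      quadraticChar (ZMod p) ((p - k : ℕ) : ZMod p) = -quadraticChar (ZMod p) k := by
    have := quadDirichlet_neg h8 (k : ZMod p)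
    rw [quadDirichlet_apply, quadDirichlet_apply] at this
    rw [Nat.cast_sub hk, ZMod.natCast_self, zero_sub]
    exact_mod_cast this
  have hT := sum_mul_eq_neg_mul_sum_half (m := 2 * t + 1)
    (c := fun k ↦ quadraticChar (ZMod p) (k : ZMod p)) (by simp)
    (fun k hk ↦ by
      rw [show 2 * (2 * t + 1) + 1 = p by omega] at hk ⊢
      exact hneg k hk) h2
  have hS := sum_quarter_eq_sum_half (t := t)
    (c := fun k ↦ quadraticChar (ZMod p) (k : ZMod p)) (fun k hk ↦ by
      rw [← hp] at hk ⊢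
      exact hneg k hk) h2
  have hQ := two_mul_Qcount_four_sub h8
  rw [ht] at hQ ⊢
  rw [show 2 * (2 * t + 1) + 1 = p by omega, ← hS, ← hQ] at hT
  have hL := sqrt_mul_re_LFunction_one h8
  rw [hT] at hL
  have hp0 : (p : ℝ) ≠ 0 := by exact_mod_cast (Fact.out : p.Prime).ne_zero
  have hpt : (p : ℝ) = 4 * t + 3 := by exact_mod_cast hp
  have hpt' : 2 * (2 * (t : ℝ) + 1) + 1 = p := by rw [hpt]; ring
  rw [hL]
  push_cast
  rw [hpt']
  field_simp

end

end

theorem stmt10 (ε : ℝ) (hε0 : 0 < ε) (hε : ε < 1 / 2) :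
    ∃ C : ℝ, 0 < C ∧ ∀ p : ℕ, p.Prime → p % 8 = 7 →
      (Qcount p 4 : ℝ) - (((p - 1) / 4 : ℕ) : ℝ) / 2 ≥ C * (p : ℝ) ^ ((1 : ℝ) / 2 - ε) := by
  let ι := {p : ℕ // p.Prime ∧ p % 8 = 7}
  have hι (i : ι) : Fact (i : ℕ).Prime := ⟨i.2.1⟩
  obtain ⟨C, hC, h⟩ := DirichletCharacter.exists_mul_rpow_le_re_LFunction_one_of_coprime
    (fun i : ι ↦ (i : ℕ)) (fun i ↦ quadDirichlet (i : ℕ))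
    (fun i ↦ quadDirichlet_ne_one (by have := i.2.2; omega)) (fun i ↦ quadDirichlet_sq (i : ℕ))
    (fun i j hij ↦ (Nat.coprime_primes i.2.1 j.2.1).mpr fun he ↦ hij (Subtype.ext he))
    hε0 (by linarith)
  have hpi := Real.pi_pos
  refine ⟨C / (2 * Real.pi), by positivity, fun p hp h8 ↦ ?_⟩
  have : Fact p.Prime := ⟨hp⟩
  have hp0 : (0 : ℝ) < p := by exact_mod_cast hp.pos
  have hL : C * (p : ℝ) ^ (-ε) ≤ ((quadDirichlet p).LFunction 1).re := h ⟨p, hp, h8⟩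
  rw [Qcount_four_sub_eq h8, ge_iff_le, sub_eq_add_neg, Real.rpow_add hp0, ← Real.sqrt_eq_rpow,
    div_mul_eq_mul_div, mul_left_comm]
  gcongr
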